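/- L_{ω₁} is, up to isomorphism, the unique well-founded model of (a sufficiently strong fragment of) ZF⁻ + V=L in which the canonical definable well-order <_L has order type exactly ω₁. -/

import Mathlib

open FirstOrder
open Cardinal

/-- The language of set theory: one binary relation `∈`. -/
def memLang : FirstOrder.Language.{0, 0} where
  Functions _ := Empty
  Relations m := PLift (m = 2)

/-- The `∈`-structure on any type equipped with a binary relation `E`. -/
def eStruc {A : Type 1} (E : A → A → Prop) : memLang.Structure A where
  funMap f _ := Empty.elim f
  RelMap r v := E (v (Fin.cast r.down.symm 0)) (v (Fin.cast r.down.symm 1))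

/-- The `∈`-structure on a class `M` of sets. -/
def memStruc (M : Set ZFSet) : memLang.Structure ↥M :=
  eStruc (fun x y : ↥M => (x : ZFSet) ∈ (y : ZFSet))

/-- `X` is a subset of `M` first-order definable with parameters over `(M, ∈)`. -/
def FODef (M X : Set ZFSet) : Prop :=
  X ⊆ M ∧ ∃ (n : ℕ) (φ : memLang.Formula (Fin (n + 1))) (a : Fin n → ↥M),
    X = {b | ∃ hb : b ∈ M,
      letI := memStruc M
      φ.Realize (Fin.snoc (fun i => (a i : ↥M)) ⟨b, hb⟩)}

/-- Gödel's constructible hierarchy `L_α` (as classes of `ZFSet`s). -/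
noncomputable def LLevel (o : Ordinal.{0}) : Set ZFSet :=
  Ordinal.limitRecOn o ∅
    (fun _ prev => {x : ZFSet | x.toSet ⊆ prev ∧ FODef prev x.toSet})
    (fun o _ ih => {x : ZFSet | ∃ o', ∃ h : o' < o, x ∈ ih o' h})

/-- `L_{ω₁}`. -/
noncomputable def LOmega1 : Set ZFSet := LLevel ((aleph 1).ord)

noncomputable instance : memLang.Structure ↥LOmega1 := memStruc LOmega1

/-- `E` is extensional. -/
def Extensional {A : Type 1} (E : A → A → Prop) : Prop :=
  ∀ x y : A, (∀ z, E z x ↔ E z y) → x = y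

/-- The model `(A, E)` satisfies the sentence `σ`. -/
def SatSen {A : Type 1} (E : A → A → Prop) (σ : memLang.Sentence) : Prop :=
  letI := eStruc E
  σ.Realize A

/-- The binary relation on `A` defined in the model `(A, E)` by the formula
`wo(v₀, v₁)`. -/
def DefRel {A : Type 1} (E : A → A → Prop) (wo : memLang.Formula (Fin 2)) (a b : A) :
    Prop :=
  letI := eStruc E
  wo.Realize ![a, b]

/-! ### Uniformly definable predicates -/

/-- The relation symbol of `memLang`. -/
def memRel : memLang.Relations 2 := PLift.up rfl

/-- A predicate on assignments, given for all `∈`-structures simultaneously, that is defined by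
one formula of `memLang`. -/
def UDef {ι : Type} (P : ∀ (A : Type 1), (A → A → Prop) → (ι → A) → Prop) : Prop :=
  ∃ φ : memLang.Formula ι, ∀ (A : Type 1) (E : A → A → Prop) (v : ι → A),
    (letI := eStruc E; φ.Realize v) ↔ P A E v

namespace UDef

variable {ι : Type}

theorem mem (i j : ι) : UDef fun _ E v => E (v i) (v j) := by
  refine ⟨memRel.formula ![Language.Term.var i, Language.Term.var j], fun A E v => ?_⟩
  let _ := eStruc E
  exact Language.Formula.realize_rel

theorem eq (i j : ι) : UDef fun _ _ v => v i = v j := by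
  refine ⟨Language.Term.equal (Language.Term.var i) (Language.Term.var j), fun A E v => ?_⟩
  let _ := eStruc E
  simp [Language.Formula.realize_equal]

theorem not {P} (h : UDef (ι := ι) P) : UDef fun A E v => ¬ P A E v := by
  obtain ⟨φ, hφ⟩ := h
  refine ⟨φ.not, fun A E v => ?_⟩
  let _ := eStruc E
  exact Language.Formula.realize_not.trans (not_congr (hφ A E v))

theorem imp {P Q} (hP : UDef (ι := ι) P) (hQ : UDef Q) : UDef fun A E v => P A E v → Q A E v := by
  obtain ⟨φ, hφ⟩ := hP
  obtain ⟨ψ, hψ⟩ := hQ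
  refine ⟨φ.imp ψ, fun A E v => ?_⟩
  let _ := eStruc E
  exact Language.Formula.realize_imp.trans (imp_congr (hφ A E v) (hψ A E v))

theorem congr {P Q} (hP : UDef (ι := ι) P) (h : ∀ A E v, P A E v ↔ Q A E v) : UDef Q := by
  obtain ⟨φ, hφ⟩ := hP
  exact ⟨φ, fun A E v => (hφ A E v).trans (h A E v)⟩

theorem and {P Q} (hP : UDef (ι := ι) P) (hQ : UDef Q) : UDef fun A E v => P A E v ∧ Q A E v :=
  (hP.imp hQ.not).not.congr fun _ _ _ => by tauto

theorem or {P Q} (hP : UDef (ι := ι) P) (hQ : UDef Q) : UDef fun A E v => P A E v ∨ Q A E v :=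
  (hP.not.imp hQ).congr fun _ _ _ => by tauto

theorem iff {P Q} (hP : UDef (ι := ι) P) (hQ : UDef Q) :
    UDef fun A E v => (P A E v ↔ Q A E v) :=
  ((hP.imp hQ).and (hQ.imp hP)).congr fun _ _ _ => by tauto

theorem const (p : Prop) : UDef (ι := ι) fun _ _ _ => p := by
  by_cases hp : p
  · exact ⟨⊤, fun A E v => by simp [hp]⟩
  · exact ⟨⊥, fun A E v => by simp [hp]⟩

theorem ex {P : ∀ (A : Type 1), (A → A → Prop) → (ι → A) → A → Prop}
    (h : UDef (ι := Option ι) fun A E w => P A E (fun i => w (some i)) (w none)) :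
    UDef fun A E v => ∃ a, P A E v a := by
  obtain ⟨φ, hφ⟩ := h
  refine ⟨(Language.BoundedFormula.relabel (n := 1) (k := 0)
    (fun o : Option ι => o.elim (Sum.inr 0) Sum.inl) φ).ex, fun A E v => ?_⟩
  let _ := eStruc E
  unfold Language.Formula.Realize
  rw [Language.BoundedFormula.realize_ex]
  refine exists_congr fun a => ?_
  rw [Language.BoundedFormula.realize_relabel]
  have := hφ A E (fun o => o.elim a v)
  simp only [Option.elim] at this
  rw [← this, Language.Formula.Realize]
  have e : (Sum.elim v ((Fin.snoc (default : Fin 0 → A) a : Fin 1 → A) ∘ Fin.castAdd 0) ∘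
      (fun o : Option ι => o.elim (Sum.inr 0) Sum.inl)) = (fun o => o.elim a v) := by
    funext o
    cases o <;> rfl
  rw [iff_iff_eq]
  congr 1
  exact Subsingleton.elim _ _

theorem all {P : ∀ (A : Type 1), (A → A → Prop) → (ι → A) → A → Prop}
    (h : UDef (ι := Option ι) fun A E w => P A E (fun i => w (some i)) (w none)) :
    UDef fun A E v => ∀ a, P A E v a :=
  (ex (P := fun A E v a => ¬ P A E v a) h.not).not.congr fun _ _ _ => by push Not; rfl

theorem exFin : ∀ {n : ℕ} {P : Fin n → ∀ (A : Type 1), (A → A → Prop) → (ι → A) → Prop},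
    (∀ i, UDef (P i)) → UDef fun A E v => ∃ i, P i A E v
  | 0, _, _ => (const False).congr fun _ _ _ => by simp
  | n + 1, P, h => ((h 0).or (exFin (P := fun i => P i.succ) fun i => h i.succ)).congr
      fun _ _ _ => by rw [Fin.exists_fin_succ]

theorem allFin {n : ℕ} {P : Fin n → ∀ (A : Type 1), (A → A → Prop) → (ι → A) → Prop}
    (h : ∀ i, UDef (P i)) : UDef fun A E v => ∀ i, P i A E v :=
  (exFin fun i => (h i).not).not.congr fun _ _ _ => by push Not; rfl

theorem reindex {κ : Type} {P} (h : UDef (ι := ι) P) (g : ι → κ) :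
    UDef fun A E v => P A E (fun i => v (g i)) := by
  obtain ⟨φ, hφ⟩ := h
  refine ⟨φ.relabel g, fun A E v => ?_⟩
  let _ := eStruc E
  exact Language.Formula.realize_relabel.trans (hφ A E _)

end UDef

/-! ### Set-theoretic notions relativized to an arbitrary `∈`-structure -/

section Relativized

variable {A : Type 1} (E : A → A → Prop)

/-- `p` is the Kuratowski pair of `x` and `y`. -/
def IsPair (p x y : A) : Prop :=
  ∀ z, E z p ↔ (∀ w, E w z ↔ w = x) ∨ (∀ w, E w z ↔ w = x ∨ w = y)

/-- The pair of `x` and `y` is an element of `Q`. -/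
def PMem (x y Q : A) : Prop := ∃ p, IsPair E p x y ∧ E p Q

/-- `z` is the nested pair `((s, x), y)`. -/
def IsTriple (z s x y : A) : Prop := ∃ p, IsPair E p s x ∧ IsPair E z p y

/-- `z` is a member of the value at `(a, b)` of the `i`-th basic operation. -/
def Op : Fin 10 → A → A → A → Prop
  | 0, _, _, _ => True
  | 1, a, b, z => z = a ∨ z = b
  | 2, a, b, z => PMem E b z a
  | 3, a, b, z => E z a ∧ ¬ E z b
  | 4, a, b, z => ∃ x y, E x a ∧ E y b ∧ IsPair E z x y
  | 5, a, _, z => ∃ y, PMem E z y a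
  | 6, a, b, z => ∃ s x y, E s a ∧ E x b ∧ E y b ∧ IsTriple E z s x y ∧ E x y
  | 7, a, b, z => ∃ s x y, E s a ∧ E x b ∧ E y b ∧ IsTriple E z s x y ∧ E y x
  | 8, a, b, z => ∃ s x y, E s a ∧ E x b ∧ E y b ∧ IsTriple E z s x y ∧ x = y
  | 9, a, b, z => ∃ s x y, PMem E s y a ∧ E x b ∧ IsTriple E z s x y

/-- `y` is the trace on the field of `Q` of the `i`-th operation at `a` and `b`. -/
def OpRep (Q : A) (i : Fin 10) (a b y : A) : Prop :=
  PMem E a a Q ∧ PMem E b b Q ∧ ∀ z, E z y ↔ PMem E z z Q ∧ Op E i a b z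

/-- `y` is generated from the field of `Q` but does not belong to it. -/
def New (Q y : A) : Prop := ¬ PMem E y y Q ∧ ∃ i a b, OpRep E Q i a b y

/-- The lexicographic order on triples induced by `Q`. -/
def LexTriple (Q : A) (i : Fin 10) (a b : A) (j : Fin 10) (c d : A) : Prop :=
  i < j ∨ i = j ∧ ((PMem E a c Q ∧ ¬ a = c) ∨ (a = c ∧ PMem E b d Q))

/-- Comparison of generated elements by their least representations. -/
def LexLe (Q x y : A) : Prop :=
  ∃ i a b, OpRep E Q i a b x ∧ ∀ j c d, OpRep E Q j c d y → LexTriple E Q i a b j c d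

/-- The order following `Q` in the hierarchy of orders. -/
def NextLe (Q x y : A) : Prop :=
  PMem E x y Q ∨ (PMem E x x Q ∧ New E Q y) ∨ (New E Q x ∧ New E Q y ∧ LexLe E Q x y)

/-- `p` is a pair in the order following `Q`. -/
def OrdNext (Q p : A) : Prop := ∃ x y, IsPair E p x y ∧ NextLe E Q x y

/-- `p` is the pair `(∅, ∅)`. -/
def OrdBase (p : A) : Prop := ∃ x, (∀ z, ¬ E z x) ∧ IsPair E p x x

/-- The field of `Q` is an element of the field of `R`. -/
def OrdTag (Q R : A) : Prop := ∃ d, (∀ x, E x d ↔ PMem E x x Q) ∧ PMem E d d R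

/-- `C` is a derivation of definable relations over `X`, with elements tagged along `E`. -/
def Deriv (X C : A) : Prop :=
  ∀ k D, PMem E k D C →
    (∀ z, E z D ↔ ∀ w, ¬ E w z) ∨
    (∃ k' B, E k' k ∧ PMem E k' B C ∧ ∃ i, 4 ≤ i ∧ ∀ z, E z D ↔ Op E i B X z) ∨
    (∃ k' B l' B', E k' k ∧ PMem E k' B C ∧ E l' k ∧ PMem E l' B' C ∧
      ∀ z, E z D ↔ Op E 3 B B' z)

/-- `D` occurs in a derivation over `X`. -/
def Derivable (X D : A) : Prop := ∃ C k, Deriv E X C ∧ PMem E k D C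

/-- `z` is a section of a derivable relation over `X`. -/
def DefNext (X z : A) : Prop := ∃ D p, Derivable E X D ∧ ∀ x, E x z ↔ PMem E p x D

end Relativized

/-- `C` is a set of stages of the iteration with start `B`, steps `N` and precedence `G`. -/
def Hist (B : ∀ (A : Type 1), (A → A → Prop) → A → Prop)
    (N G : ∀ (A : Type 1), (A → A → Prop) → A → A → Prop)
    {A : Type 1} (E : A → A → Prop) (C : A) : Prop :=
  ∀ R, E R C → ∀ x, E x R ↔ B A E x ∨ ∃ Q, E Q C ∧ G A E Q R ∧ N A E Q x

/-- `R` is a stage of the iteration with start `B`, steps `N` and precedence `G`. -/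
def Lev (B : ∀ (A : Type 1), (A → A → Prop) → A → Prop)
    (N G : ∀ (A : Type 1), (A → A → Prop) → A → A → Prop)
    {A : Type 1} (E : A → A → Prop) (R : A) : Prop :=
  ∃ C, E R C ∧ Hist B N G E C

namespace UDef

variable {ι : Type}

theorem isPair (p x y : ι) : UDef fun _ E v => IsPair E (v p) (v x) (v y) := by
  unfold IsPair
  repeat' first
    | with_reducible exact UDef.mem _ _
    | with_reducible exact UDef.eq _ _
    | with_reducible refine UDef.all ?_
    | with_reducible refine UDef.iff ?_ ?_
    | with_reducible refine UDef.or ?_ ?_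

theorem pmem (x y q : ι) : UDef fun _ E v => PMem E (v x) (v y) (v q) :=
  ex ((isPair _ _ _).and (mem _ _))

theorem isTriple (z s x y : ι) : UDef fun _ E v => IsTriple E (v z) (v s) (v x) (v y) :=
  ex ((isPair _ _ _).and (isPair _ _ _))

theorem op (i : Fin 10) (a b z : ι) : UDef fun _ E v => Op E i (v a) (v b) (v z) := by
  fin_cases i <;> simp only [Op]
  all_goals
    repeat' first
      | with_reducible exact UDef.const _
      | with_reducible exact UDef.mem _ _
      | with_reducible exact UDef.eq _ _
      | with_reducible exact UDef.pmem _ _ _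
      | with_reducible exact UDef.isPair _ _ _
      | with_reducible exact UDef.isTriple _ _ _ _
      | with_reducible refine UDef.ex ?_
      | with_reducible refine UDef.and ?_ ?_
      | with_reducible refine UDef.or ?_ ?_
      | with_reducible refine UDef.not ?_

theorem opRep (i : Fin 10) (q a b y : ι) : UDef fun _ E v => OpRep E (v q) i (v a) (v b) (v y) :=
  (pmem _ _ _).and ((pmem _ _ _).and (all ((mem _ _).iff ((pmem _ _ _).and (op _ _ _ _)))))

theorem new (q y : ι) : UDef fun _ E v => New E (v q) (v y) :=
  (pmem _ _ _).not.and (exFin fun _ => ex (ex (opRep _ _ _ _ _)))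

theorem lexTriple (q : ι) (i : Fin 10) (a b : ι) (j : Fin 10) (c d : ι) :
    UDef fun _ E v => LexTriple E (v q) i (v a) (v b) j (v c) (v d) :=
  (const _).or ((const _).and (((pmem _ _ _).and (eq _ _).not).or ((eq _ _).and (pmem _ _ _))))

theorem lexLe (q x y : ι) : UDef fun _ E v => LexLe E (v q) (v x) (v y) :=
  exFin fun _ => ex (ex ((opRep _ _ _ _ _).and
    (allFin fun _ => all (all ((opRep _ _ _ _ _).imp (lexTriple _ _ _ _ _ _ _))))))

theorem nextLe (q x y : ι) : UDef fun _ E v => NextLe E (v q) (v x) (v y) :=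
  (pmem _ _ _).or (((pmem _ _ _).and (new _ _)).or ((new _ _).and ((new _ _).and (lexLe _ _ _))))

theorem ordNext (q p : ι) : UDef fun _ E v => OrdNext E (v q) (v p) :=
  ex (ex ((isPair _ _ _).and (nextLe _ _ _)))

theorem ordBase (p : ι) : UDef fun _ E v => OrdBase E (v p) :=
  ex ((all (mem _ _).not).and (isPair _ _ _))

theorem ordTag (q r : ι) : UDef fun _ E v => OrdTag E (v q) (v r) :=
  ex ((all ((mem _ _).iff (pmem _ _ _))).and (pmem _ _ _))

theorem deriv (x c : ι) : UDef fun _ E v => Deriv E (v x) (v c) := by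
  unfold Deriv
  repeat' first
    | with_reducible exact UDef.const _
    | with_reducible exact UDef.mem _ _
    | with_reducible exact UDef.pmem _ _ _
    | with_reducible exact UDef.op _ _ _ _
    | with_reducible refine UDef.exFin fun _ => ?_
    | with_reducible refine UDef.ex ?_
    | with_reducible refine UDef.all ?_
    | with_reducible refine UDef.and ?_ ?_
    | with_reducible refine UDef.or ?_ ?_
    | with_reducible refine UDef.not ?_
    | with_reducible refine UDef.iff ?_ ?_
    | with_reducible refine UDef.imp ?_ ?_

theorem derivable (x d : ι) : UDef fun _ E v => Derivable E (v x) (v d) :=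
  ex (ex ((deriv _ _).and (pmem _ _ _)))

theorem defNext (x z : ι) : UDef fun _ E v => DefNext E (v x) (v z) :=
  ex (ex ((derivable _ _).and (all ((mem _ _).iff (pmem _ _ _)))))

theorem lev {B N G} (hB : ∀ {κ : Type} (x : κ), UDef fun A E v => B A E (v x))
    (hN : ∀ {κ : Type} (x y : κ), UDef fun A E v => N A E (v x) (v y))
    (hG : ∀ {κ : Type} (x y : κ), UDef fun A E v => G A E (v x) (v y)) (r : ι) :
    UDef fun _ E v => Lev B N G E (v r) :=
  ex ((mem _ _).and (all ((mem _ _).imp (all ((mem _ _).iff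
    ((hB _).or (ex ((mem _ _).and ((hG _ _).and (hN _ _))))))))))

end UDef

/-! ### Absoluteness for transitive classes closed under pairing -/

/-- Membership on the universe. -/
abbrev memV : ZFSet.{0} → ZFSet.{0} → Prop := fun x y => x ∈ y

/-- Membership on a class. -/
abbrev memOn (K : Set ZFSet.{0}) : ↥K → ↥K → Prop := fun x y => (x : ZFSet) ∈ (y : ZFSet)

/-- `K` is transitive and closed under pairing. -/
structure TransPair (K : Set ZFSet.{0}) : Prop where
  trans : ∀ {x z : ZFSet}, x ∈ K → z ∈ x → z ∈ K
  upair : ∀ {x y : ZFSet}, x ∈ K → y ∈ K → ({x, y} : ZFSet) ∈ K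

namespace TransPair

variable {K : Set ZFSet.{0}}

theorem single (hK : TransPair K) {x : ZFSet} (hx : x ∈ K) : ({x} : ZFSet) ∈ K := by
  simpa using hK.upair hx hx

theorem pair (hK : TransPair K) {x y : ZFSet} (hx : x ∈ K) (hy : y ∈ K) : ZFSet.pair x y ∈ K :=
  hK.upair (hK.single hx) (hK.upair hx hy)

theorem of_pair (hK : TransPair K) {x y : ZFSet} (h : ZFSet.pair x y ∈ K) : x ∈ K ∧ y ∈ K := by
  have h1 : ({x, y} : ZFSet) ∈ K := hK.trans h (by simp [ZFSet.pair])
  exact ⟨hK.trans h1 (by simp), hK.trans h1 (by simp)⟩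

theorem of_pair_mem (hK : TransPair K) {x y Q : ZFSet} (hQ : Q ∈ K) (h : ZFSet.pair x y ∈ Q) :
    x ∈ K ∧ y ∈ K :=
  hK.of_pair (hK.trans hQ h)

theorem ext_iff (hK : TransPair K) {x : ZFSet} (hx : x ∈ K) {p : ZFSet → Prop} (hp : ∀ z, p z → z ∈ K) :
    (∀ z : ↥K, (z : ZFSet) ∈ x ↔ p z) ↔ ∀ z, z ∈ x ↔ p z := by
  refine ⟨fun h z => ⟨fun hz => (h ⟨z, hK.trans hx hz⟩).1 hz, fun hz => (h ⟨z, hp z hz⟩).2 hz⟩,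
    fun h z => h z⟩

theorem isPair (hK : TransPair K) {p x y : ↥K} :
    IsPair (memOn K) p x y ↔ (p : ZFSet) = ZFSet.pair x y := by
  have e1 : ∀ z : ↥K, (∀ w : ↥K, memOn K w z ↔ w = x) ↔ (z : ZFSet) = {(x : ZFSet)} := by
    intro z
    simp only [Subtype.ext_iff]
    rw [hK.ext_iff z.2 (p := fun w => w = x) (by rintro _ rfl; exact x.2)]
    simp [ZFSet.ext_iff]
  have e2 : ∀ z : ↥K, (∀ w : ↥K, memOn K w z ↔ w = x ∨ w = y) ↔
      (z : ZFSet) = {(x : ZFSet), (y : ZFSet)} := by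
    intro z
    simp only [Subtype.ext_iff]
    rw [hK.ext_iff z.2 (p := fun w => w = x ∨ w = y) (by rintro _ (rfl | rfl); exacts [x.2, y.2])]
    simp [ZFSet.ext_iff]
  unfold IsPair
  simp only [e1, e2]
  rw [hK.ext_iff p.2 (p := fun z => z = {(x : ZFSet)} ∨ z = {(x : ZFSet), (y : ZFSet)})
    (by rintro _ (rfl | rfl); exacts [hK.single x.2, hK.upair x.2 y.2])]
  simp [ZFSet.ext_iff (x := (p : ZFSet)), ZFSet.pair]

theorem pmem (hK : TransPair K) {x y Q : ↥K} :
    PMem (memOn K) x y Q ↔ ZFSet.pair x y ∈ (Q : ZFSet) := by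
  unfold PMem
  simp only [hK.isPair]
  constructor
  · rintro ⟨p, hp, h⟩
    rwa [← hp]
  · intro h
    exact ⟨⟨_, hK.pair x.2 y.2⟩, rfl, h⟩

theorem isTriple (hK : TransPair K) {z s x y : ↥K} :
    IsTriple (memOn K) z s x y ↔ (z : ZFSet) = ZFSet.pair (ZFSet.pair s x) y := by
  unfold IsTriple
  simp only [hK.isPair]
  constructor
  · rintro ⟨p, hp, h⟩
    rwa [← hp]
  · intro h
    exact ⟨⟨_, hK.pair s.2 x.2⟩, rfl, h⟩

end TransPair

@[simp] theorem isPair_memV {p x y : ZFSet} : IsPair memV p x y ↔ p = ZFSet.pair x y := by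
  simp only [IsPair, memV, ZFSet.pair, ZFSet.ext_iff (x := p), ZFSet.mem_pair]
  simp only [ZFSet.ext_iff, ZFSet.mem_pair, ZFSet.mem_singleton]

@[simp] theorem pmem_memV {x y Q : ZFSet} : PMem memV x y Q ↔ ZFSet.pair x y ∈ Q := by
  simp [PMem]

@[simp] theorem isTriple_memV {z s x y : ZFSet} :
    IsTriple memV z s x y ↔ z = ZFSet.pair (ZFSet.pair s x) y := by
  simp [IsTriple]

namespace TransPair

variable {K : Set ZFSet.{0}}

theorem op_mem (hK : TransPair K) {i : Fin 10} (hi : i ≠ 0) {a b z : ZFSet} (ha : a ∈ K) (hb : b ∈ K)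
    (h : Op memV i a b z) : z ∈ K := by
  fin_cases i <;> simp only [Op, pmem_memV, isPair_memV, isTriple_memV] at h
  · exact absurd rfl hi
  · rcases h with rfl | rfl <;> assumption
  · exact (hK.of_pair_mem ha h).2
  · exact hK.trans ha h.1
  · obtain ⟨x, y, hx, hy, rfl⟩ := h
    exact hK.pair (hK.trans ha hx) (hK.trans hb hy)
  · obtain ⟨y, h⟩ := h
    exact (hK.of_pair_mem ha h).1
  · obtain ⟨s, x, y, hs, hx, hy, rfl, -⟩ := h
    exact hK.pair (hK.pair (hK.trans ha hs) (hK.trans hb hx)) (hK.trans hb hy)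
  · obtain ⟨s, x, y, hs, hx, hy, rfl, -⟩ := h
    exact hK.pair (hK.pair (hK.trans ha hs) (hK.trans hb hx)) (hK.trans hb hy)
  · obtain ⟨s, x, y, hs, hx, hy, rfl, -⟩ := h
    exact hK.pair (hK.pair (hK.trans ha hs) (hK.trans hb hx)) (hK.trans hb hy)
  · obtain ⟨s, x, y, hs, hx, rfl⟩ := h
    have := hK.of_pair_mem ha hs
    exact hK.pair (hK.pair this.1 (hK.trans hb hx)) this.2

theorem op (hK : TransPair K) (i : Fin 10) (a b z : ↥K) :
    Op (memOn K) i a b z ↔ Op memV i (a : ZFSet) b z := by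
  have tr : ∀ (x : ↥K) {z : ZFSet}, z ∈ (x : ZFSet) → z ∈ K := fun x _ h => hK.trans x.2 h
  fin_cases i <;>
    simp only [Op, hK.pmem, hK.isPair, hK.isTriple, pmem_memV, isPair_memV, isTriple_memV,
      Subtype.ext_iff]
  · exact ⟨fun ⟨x, y, hx, hy, h⟩ => ⟨x, y, hx, hy, h⟩,
      fun ⟨x, y, hx, hy, h⟩ => ⟨⟨x, tr _ hx⟩, ⟨y, tr _ hy⟩, hx, hy, h⟩⟩
  · exact ⟨fun ⟨y, h⟩ => ⟨y, h⟩, fun ⟨y, h⟩ => ⟨⟨y, (hK.of_pair_mem a.2 h).2⟩, h⟩⟩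
  · exact ⟨fun ⟨s, x, y, hs, hx, hy, h⟩ => ⟨s, x, y, hs, hx, hy, h⟩,
      fun ⟨s, x, y, hs, hx, hy, h⟩ => ⟨⟨s, tr _ hs⟩, ⟨x, tr _ hx⟩, ⟨y, tr _ hy⟩, hs, hx, hy, h⟩⟩
  · exact ⟨fun ⟨s, x, y, hs, hx, hy, h⟩ => ⟨s, x, y, hs, hx, hy, h⟩,
      fun ⟨s, x, y, hs, hx, hy, h⟩ => ⟨⟨s, tr _ hs⟩, ⟨x, tr _ hx⟩, ⟨y, tr _ hy⟩, hs, hx, hy, h⟩⟩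
  · exact ⟨fun ⟨s, x, y, hs, hx, hy, h⟩ => ⟨s, x, y, hs, hx, hy, h⟩,
      fun ⟨s, x, y, hs, hx, hy, h⟩ => ⟨⟨s, tr _ hs⟩, ⟨x, tr _ hx⟩, ⟨y, tr _ hy⟩, hs, hx, hy, h⟩⟩
  · exact ⟨fun ⟨s, x, y, hs, hx, h⟩ => ⟨s, x, y, hs, hx, h⟩,
      fun ⟨s, x, y, hs, hx, h⟩ => ⟨⟨s, (hK.of_pair_mem a.2 hs).1⟩, ⟨x, tr _ hx⟩,
        ⟨y, (hK.of_pair_mem a.2 hs).2⟩, hs, hx, h⟩⟩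

theorem pmemV (hK : TransPair K) {x y Q : ↥K} :
    PMem (memOn K) x y Q ↔ PMem memV (x : ZFSet) y Q := by
  rw [hK.pmem, pmem_memV]

theorem fld_mem (hK : TransPair K) {Q : ↥K} {x y : ZFSet} (h : PMem memV x y Q) : x ∈ K ∧ y ∈ K :=
  hK.of_pair_mem Q.2 (pmem_memV.1 h)

theorem opRep (hK : TransPair K) (Q : ↥K) (i : Fin 10) (a b y : ↥K) :
    OpRep (memOn K) Q i a b y ↔ OpRep memV (Q : ZFSet) i a b y := by
  unfold OpRep
  rw [hK.pmemV, hK.pmemV, ← hK.ext_iff y.2 (fun z hz => (hK.fld_mem hz.1).1)]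
  simp only [hK.pmemV, hK.op]

theorem exists_opRep (hK : TransPair K) (Q : ↥K) {p : ZFSet → ZFSet → Prop} (i : Fin 10) (y : ZFSet) :
    (∃ a b : ↥K, OpRep memV (Q : ZFSet) i a b y ∧ p a b) ↔
      ∃ a b, OpRep memV (Q : ZFSet) i a b y ∧ p a b :=
  ⟨fun ⟨a, b, h⟩ => ⟨a, b, h⟩, fun ⟨a, b, h⟩ =>
    ⟨⟨a, (hK.fld_mem h.1.1).1⟩, ⟨b, (hK.fld_mem h.1.2.1).1⟩, h⟩⟩

theorem forall_opRep (hK : TransPair K) (Q : ↥K) {p : ZFSet → ZFSet → Prop} (i : Fin 10) (y : ZFSet) :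
    (∀ a b : ↥K, OpRep memV (Q : ZFSet) i a b y → p a b) ↔
      ∀ a b, OpRep memV (Q : ZFSet) i a b y → p a b :=
  ⟨fun h a b hr => h ⟨a, (hK.fld_mem hr.1).1⟩ ⟨b, (hK.fld_mem hr.2.1).1⟩ hr,
    fun h a b hr => h a b hr⟩

theorem new (hK : TransPair K) (Q y : ↥K) : New (memOn K) Q y ↔ New memV (Q : ZFSet) y := by
  unfold New
  simp only [hK.pmemV, hK.opRep]
  refine and_congr Iff.rfl (exists_congr fun i => ?_)
  simpa using hK.exists_opRep Q (p := fun _ _ => True) i y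

theorem lexTriple (hK : TransPair K) (Q : ↥K) (i : Fin 10) (a b : ↥K) (j : Fin 10) (c d : ↥K) :
    LexTriple (memOn K) Q i a b j c d ↔ LexTriple memV (Q : ZFSet) i a b j c d := by
  simp only [LexTriple, hK.pmemV, Subtype.ext_iff]

theorem lexLe (hK : TransPair K) (Q x y : ↥K) :
    LexLe (memOn K) Q x y ↔ LexLe memV (Q : ZFSet) x y := by
  unfold LexLe
  simp only [hK.opRep, hK.lexTriple]
  refine exists_congr fun i => ?_
  have := hK.exists_opRep Q (p := fun a b => ∀ j, ∀ c d, OpRep memV (Q : ZFSet) j c d y →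
    LexTriple memV (Q : ZFSet) i a b j c d) i x
  rw [← this]
  refine exists_congr fun a => exists_congr fun b => and_congr Iff.rfl (forall_congr' fun j => ?_)
  exact hK.forall_opRep Q (p := fun c d => LexTriple memV (Q : ZFSet) i a b j c d) j y

theorem nextLe (hK : TransPair K) (Q x y : ↥K) :
    NextLe (memOn K) Q x y ↔ NextLe memV (Q : ZFSet) x y := by
  simp only [NextLe, hK.pmemV, hK.new, hK.lexLe]

theorem ordNext (hK : TransPair K) (Q p : ↥K) :
    OrdNext (memOn K) Q p ↔ OrdNext memV (Q : ZFSet) p := by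
  simp only [OrdNext, hK.isPair, hK.nextLe, isPair_memV]
  refine ⟨fun ⟨x, y, h⟩ => ⟨x, y, h⟩, fun ⟨x, y, h⟩ => ?_⟩
  have := hK.of_pair (h.1 ▸ p.2)
  exact ⟨⟨x, this.1⟩, ⟨y, this.2⟩, h⟩

theorem ordBase (hK : TransPair K) (p : ↥K) : OrdBase (memOn K) p ↔ OrdBase memV (p : ZFSet) := by
  simp only [OrdBase, hK.isPair, isPair_memV]
  constructor
  · rintro ⟨x, h0, hp⟩
    exact ⟨x, fun z hz => h0 ⟨z, hK.trans x.2 hz⟩ hz, hp⟩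
  · rintro ⟨x, h0, hp⟩
    exact ⟨⟨x, (hK.of_pair (hp ▸ p.2)).1⟩, fun z => h0 z, hp⟩

theorem ordTag (hK : TransPair K) (Q R : ↥K) :
    OrdTag (memOn K) Q R ↔ OrdTag memV (Q : ZFSet) R := by
  simp only [OrdTag, hK.pmemV]
  constructor
  · rintro ⟨d, h, hd⟩
    exact ⟨d, (hK.ext_iff d.2 (p := fun x => PMem memV x x Q)
      (fun z hz => (hK.fld_mem hz).1)).1 h, hd⟩
  · rintro ⟨d, h, hd⟩
    exact ⟨⟨d, (hK.fld_mem hd).1⟩, fun x => h x, hd⟩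

theorem op_ext (hK : TransPair K) {i : Fin 10} (hi : i ≠ 0) (D a b : ↥K) :
    (∀ z, memOn K z D ↔ Op (memOn K) i a b z) ↔ ∀ z, z ∈ (D : ZFSet) ↔ Op memV i (a : ZFSet) b z := by
  simp only [hK.op]
  exact hK.ext_iff D.2 (p := fun z => Op memV i (a : ZFSet) b z) fun z => hK.op_mem hi a.2 b.2

theorem deriv (hK : TransPair K) (h0 : (∅ : ZFSet) ∈ K) (X C : ↥K) :
    Deriv (memOn K) X C ↔ Deriv memV (X : ZFSet) C := by
  have e0 : ∀ D : ↥K, (∀ z, memOn K z D ↔ ∀ w, ¬ memOn K w z) ↔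
      ∀ z, z ∈ (D : ZFSet) ↔ ∀ w, ¬ w ∈ z := by
    intro D
    rw [← hK.ext_iff D.2]
    · refine forall_congr' fun z => iff_congr Iff.rfl ⟨fun h w hw => h ⟨w, hK.trans z.2 hw⟩ hw,
        fun h w => h w⟩
    · intro z hz
      rwa [(ZFSet.eq_empty z).2 hz]
  have tr : ∀ (x : ↥K) {z : ZFSet}, z ∈ (x : ZFSet) → z ∈ K := fun x _ h => hK.trans x.2 h
  have e1 : ∀ i : Fin 10, 4 ≤ i → i ≠ 0 := by decide
  unfold Deriv
  simp only [e0, hK.pmemV, hK.op_ext (i := 3) (by decide)]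
  constructor
  · intro h k D hkD
    have := hK.fld_mem hkD
    rcases h ⟨k, this.1⟩ ⟨D, this.2⟩ hkD with h | ⟨k', B, hk, hB, i, hi, h⟩ |
      ⟨k', B, l', B', hk, hB, hl, hB', h⟩
    · exact Or.inl h
    · exact Or.inr (Or.inl ⟨k', B, hk, hB, i, hi, (hK.op_ext (e1 i hi) _ _ _).1 h⟩)
    · exact Or.inr (Or.inr ⟨k', B, l', B', hk, hB, hl, hB', h⟩)
  · intro h k D hkD
    rcases h k D hkD with h | ⟨k', B, hk, hB, i, hi, h⟩ |
      ⟨k', B, l', B', hk, hB, hl, hB', h⟩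
    · exact Or.inl h
    · have := hK.fld_mem hB
      exact Or.inr (Or.inl ⟨⟨k', this.1⟩, ⟨B, this.2⟩, hk, hB, i, hi,
        (hK.op_ext (e1 i hi) D ⟨B, this.2⟩ X).2 h⟩)
    · have h1 := hK.fld_mem hB
      have h2 := hK.fld_mem hB'
      exact Or.inr (Or.inr ⟨⟨k', h1.1⟩, ⟨B, h1.2⟩, ⟨l', h2.1⟩, ⟨B', h2.2⟩, hk, hB, hl, hB', h⟩)

end TransPair

/-! ### Hierarchies of sets -/

/-- The union of `B` and the values of `F` at the earlier stages of the hierarchy. -/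
noncomputable def hier (B : ZFSet.{0}) (F : ZFSet.{0} → ZFSet.{0}) (α : Ordinal.{0}) : ZFSet.{0} :=
  B ∪ ZFSet.iUnion fun β : Set.Iio α => F (hier B F β)
termination_by α
decreasing_by exact β.2

theorem mem_hier {B : ZFSet.{0}} {F : ZFSet.{0} → ZFSet.{0}} {α : Ordinal.{0}} {x : ZFSet.{0}} :
    x ∈ hier B F α ↔ x ∈ B ∨ ∃ β < α, x ∈ F (hier B F β) := by
  rw [hier]
  simp

/-- Definability by a uniformly definable predicate with parameters. -/
theorem fodef_of_udef {M : Set ZFSet.{0}} {n : ℕ}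
    {P : ∀ (A : Type 1), (A → A → Prop) → (Fin n → A) → A → Prop}
    (hP : UDef (ι := Option (Fin n)) fun A E w => P A E (fun i => w (some i)) (w none))
    (a : Fin n → ↥M) : FODef M {b | ∃ hb : b ∈ M, P ↥M (memOn M) a ⟨b, hb⟩} := by
  obtain ⟨φ, hφ⟩ := hP.reindex (fun o : Option (Fin n) => o.elim (Fin.last n) Fin.castSucc)
  refine ⟨fun b hb => hb.1, n, φ, a, ?_⟩
  ext b
  refine exists_congr fun hb => ?_
  refine Iff.trans ?_ (hφ ↥M (memOn M) _).symm
  simp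

theorem fodef_of_mem {x : ZFSet.{0}} {M : Set ZFSet.{0}} (hx : x ∈ M) (h : ∀ z ∈ x, z ∈ M) :
    FODef M (x : Set ZFSet) := by
  have := fodef_of_udef (M := M) (n := 1) (P := fun A E a z => E z (a 0)) (UDef.mem _ _)
    (fun _ => ⟨x, hx⟩)
  convert this using 1
  ext z
  exact ⟨fun hz => ⟨h z hz, hz⟩, fun hz => hz.2⟩

/-- The constructible hierarchy, with sets as levels. -/
noncomputable def lset : Ordinal.{0} → ZFSet.{0} :=
  hier ∅ fun Y => Y.powerset.sep fun x => FODef (Y : Set ZFSet) (x : Set ZFSet)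

theorem mem_lset {α : Ordinal.{0}} {x : ZFSet.{0}} :
    x ∈ lset α ↔ ∃ β < α, FODef (lset β : Set ZFSet) (x : Set ZFSet) := by
  unfold lset
  rw [mem_hier]
  simp only [ZFSet.notMem_empty, false_or, ZFSet.mem_sep, ZFSet.mem_powerset]
  exact exists_congr fun β => and_congr_right fun _ => ⟨fun h => h.2, fun h => ⟨h.1, h⟩⟩

theorem lset_mono {α β : Ordinal.{0}} (h : α ≤ β) {x : ZFSet} (hx : x ∈ lset α) : x ∈ lset β := by
  rw [mem_lset] at hx ⊢
  obtain ⟨γ, hγ, hx⟩ := hx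
  exact ⟨γ, hγ.trans_le h, hx⟩

theorem lset_trans {α : Ordinal.{0}} {x z : ZFSet} (hx : x ∈ lset α) (hz : z ∈ x) : z ∈ lset α := by
  obtain ⟨β, hβ, h⟩ := mem_lset.1 hx
  exact lset_mono hβ.le (h.1 hz)

theorem fodef_of_mem_lset {α : Ordinal.{0}} {x : ZFSet} (hx : x ∈ lset α) :
    FODef (lset α : Set ZFSet) (x : Set ZFSet) :=
  fodef_of_mem hx fun _ hz => lset_trans hx hz

theorem mem_lset_add_one {α : Ordinal.{0}} {x : ZFSet} :
    x ∈ lset (α + 1) ↔ FODef (lset α : Set ZFSet) (x : Set ZFSet) := by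
  refine ⟨fun h => ?_, fun h => mem_lset.2 ⟨α, lt_add_one α, h⟩⟩
  obtain ⟨β, hβ, h⟩ := mem_lset.1 h
  rcases (Order.lt_add_one_iff.1 hβ).lt_or_eq with hβ | rfl
  · exact fodef_of_mem_lset (mem_lset.2 ⟨β, hβ, h⟩)
  · assumption

theorem coe_lset (α : Ordinal.{0}) : (lset α : Set ZFSet) = LLevel α := by
  induction α using Ordinal.limitRecOn with
  | zero =>
    ext x
    simp [LLevel, mem_lset]
  | add_one α ih =>
    ext x
    have : LLevel (α + 1) = {x : ZFSet | x.toSet ⊆ LLevel α ∧ FODef (LLevel α) x.toSet} := by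
      simp [LLevel]
    rw [this, ← ih, SetLike.mem_coe, mem_lset_add_one]
    exact ⟨fun h => ⟨h.1, h⟩, fun h => h.2⟩
  | limit α hα ih =>
    ext x
    have : LLevel α = {x : ZFSet | ∃ o', ∃ _ : o' < α, x ∈ LLevel o'} := by
      unfold LLevel
      rw [Ordinal.limitRecOn_limit _ _ _ _ hα]
    rw [this, SetLike.mem_coe, mem_lset]
    constructor
    · rintro ⟨β, hβ, h⟩
      refine ⟨β + 1, hα.succ_lt hβ, ?_⟩
      rw [← ih (β + 1) (hα.succ_lt hβ)]
      exact mem_lset_add_one.2 h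
    · rintro ⟨β, hβ, h⟩
      rw [← ih _ hβ] at h
      exact ⟨β, hβ, fodef_of_mem_lset h⟩

theorem isSuccLimit_omega_one : Order.IsSuccLimit (Ordinal.omega.{0} 1) := by
  rw [← Cardinal.ord_aleph]
  exact Cardinal.isSuccLimit_ord (Cardinal.aleph0_le_aleph 1)

theorem add_one_lt_omega_one {α : Ordinal.{0}} (h : α < Ordinal.omega 1) :
    α + 1 < Ordinal.omega 1 :=
  isSuccLimit_omega_one.succ_lt h

/-- Countably many countable ordinals have a countable strict upper bound. -/
theorem exists_lt_omega_one {ι : Type*} [Countable ι] {f : ι → Ordinal.{0}}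
    (h : ∀ n, f n < Ordinal.omega 1) : ∃ α < Ordinal.omega 1, ∀ n, f n < α := by
  rcases isEmpty_or_nonempty ι with hι | hι
  · exact ⟨0, isSuccLimit_omega_one.bot_lt, fun n => hι.elim n⟩
  obtain ⟨g, hg⟩ := exists_surjective_nat ι
  refine ⟨_, add_one_lt_omega_one (Ordinal.iSup_lt_of_lt_cof (f := f ∘ g) ?_ fun n => h _),
    fun n => ?_⟩
  · rw [Cardinal.cof_omega_one, Cardinal.mk_nat]
    exact Cardinal.aleph0_lt_aleph_one
  · obtain ⟨k, rfl⟩ := hg n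
    exact Order.lt_add_one_iff.2 (Ordinal.le_iSup (f ∘ g) k)

/-- A countable set covered by an increasing sequence of length `ω₁` is covered by one term. -/
theorem Set.Countable.exists_stage {β : Type*} {S : Set β} (hS : S.Countable)
    {P : Ordinal.{0} → β → Prop} (mono : ∀ {α γ x}, α ≤ γ → P α x → P γ x)
    (h : ∀ x ∈ S, ∃ α < Ordinal.omega 1, P α x) : ∃ α < Ordinal.omega 1, ∀ x ∈ S, P α x := by
  choose f hf hP using h
  have := hS.to_subtype
  obtain ⟨α, hα, hlt⟩ := exists_lt_omega_one (f := fun x : S => f x.1 x.2) fun x => hf _ _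
  exact ⟨α, hα, fun x hx => mono (hlt ⟨x, hx⟩).le (hP x hx)⟩

theorem countable_Iio {α : Ordinal.{0}} (h : α < Ordinal.omega 1) : (Set.Iio α).Countable := by
  rw [← Cardinal.ord_aleph, Cardinal.lt_ord] at h
  rw [← Cardinal.le_aleph0_iff_set_countable, Cardinal.mk_Iio_ordinal, Cardinal.lift_le_aleph0]
  have : (aleph 1) = Order.succ ℵ₀ := by rw [Cardinal.succ_aleph0]
  rwa [this, Order.lt_succ_iff] at h

theorem mem_LOmega1 {x : ZFSet} : x ∈ LOmega1 ↔ ∃ α < Ordinal.omega 1, x ∈ lset α := by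
  unfold LOmega1
  rw [← coe_lset, SetLike.mem_coe, Cardinal.ord_aleph]
  constructor
  · intro h
    obtain ⟨β, hβ, h⟩ := mem_lset.1 h
    exact ⟨β + 1, add_one_lt_omega_one hβ, mem_lset_add_one.2 h⟩
  · rintro ⟨α, hα, h⟩
    exact lset_mono hα.le h

/-- The hierarchy of canonical orders. -/
noncomputable def rset : Ordinal.{0} → ZFSet.{0} :=
  hier {ZFSet.pair ∅ ∅} fun Q =>
    ((Q.sUnion.sUnion ∪ Q.sUnion.sUnion.powerset).prod
      (Q.sUnion.sUnion ∪ Q.sUnion.sUnion.powerset)).sep (OrdNext memV Q)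

theorem mem_sUnion_of_pmem {x y Q : ZFSet.{0}} (h : ZFSet.pair x y ∈ Q) :
    x ∈ Q.sUnion.sUnion ∧ y ∈ Q.sUnion.sUnion := by
  have h1 : ({x, y} : ZFSet) ∈ Q.sUnion :=
    ZFSet.mem_sUnion.2 ⟨_, h, by simp [ZFSet.pair]⟩
  exact ⟨ZFSet.mem_sUnion.2 ⟨_, h1, by simp⟩, ZFSet.mem_sUnion.2 ⟨_, h1, by simp⟩⟩

theorem New.subset {y Q : ZFSet.{0}} (h : New memV Q y) : y ⊆ Q.sUnion.sUnion := by
  obtain ⟨-, i, a, b, -, -, h⟩ := h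
  exact fun z hz => (mem_sUnion_of_pmem (pmem_memV.1 ((h z).1 hz).1)).1

theorem ordBase_memV {p : ZFSet.{0}} : OrdBase memV p ↔ p = ZFSet.pair ∅ ∅ := by
  simp [OrdBase, memV, ← ZFSet.eq_empty]

theorem mem_rset {α : Ordinal.{0}} {p : ZFSet} :
    p ∈ rset α ↔ OrdBase memV p ∨ ∃ β < α, OrdNext memV (rset β) p := by
  unfold rset
  rw [mem_hier, ZFSet.mem_singleton, ordBase_memV]
  simp only [ZFSet.mem_sep]
  refine or_congr_right (exists_congr fun β => and_congr_right fun _ => ⟨fun h => h.2, fun h => ⟨?_, h⟩⟩)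
  obtain ⟨x, y, hp, h⟩ := h
  rw [isPair_memV.1 hp, ZFSet.pair_mem_prod]
  simp only [ZFSet.mem_union, ZFSet.mem_powerset]
  rcases h with h | ⟨h, h'⟩ | ⟨h, h', -⟩
  · have := mem_sUnion_of_pmem (pmem_memV.1 h)
    exact ⟨Or.inl this.1, Or.inl this.2⟩
  · have := mem_sUnion_of_pmem (pmem_memV.1 h)
    exact ⟨Or.inl this.1, Or.inr h'.subset⟩
  · exact ⟨Or.inr h.subset, Or.inr h'.subset⟩

/-! ### The hierarchy of canonical orders -/

/-- `r` is a reflexive well-order of its field. -/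
structure WO (r : ZFSet.{0} → ZFSet.{0} → Prop) : Prop where
  fld : ∀ {x y}, r x y → r x x ∧ r y y
  antisymm : ∀ {x y}, r x y → r y x → x = y
  least : ∀ {S : Set ZFSet.{0}}, S.Nonempty → (∀ x ∈ S, r x x) → ∃ m ∈ S, ∀ y ∈ S, r m y

namespace WO

theorem total {r} (h : WO r) {x y : ZFSet} (hx : r x x) (hy : r y y) : r x y ∨ r y x := by
  obtain ⟨m, hm, h⟩ := h.least (S := {x, y}) ⟨x, by simp⟩ (by rintro z (rfl | rfl) <;> assumption)
  rcases hm with rfl | rfl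
  · exact Or.inl (h y (by simp))
  · exact Or.inr (h x (by simp))

theorem trans {r} (h : WO r) {x y z : ZFSet} (hxy : r x y) (hyz : r y z) : r x z := by
  obtain ⟨m, hm, h'⟩ := h.least (S := {x, y, z}) ⟨x, by simp⟩ (by
    rintro w (rfl | rfl | rfl)
    exacts [(h.fld hxy).1, (h.fld hxy).2, (h.fld hyz).2])
  rcases hm with rfl | rfl | rfl
  · exact h' z (by simp)
  · rwa [h.antisymm hxy (h' x (by simp))]
  · rwa [h.antisymm (h' y (by simp)) hyz]

section Next

variable {Q : ZFSet.{0}}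

theorem lexTriple_antisymm (h : WO fun x y => ZFSet.pair x y ∈ Q) {i j : Fin 10}
    {a b c d : ZFSet} (h1 : LexTriple memV Q i a b j c d) (h2 : LexTriple memV Q j c d i a b) :
    i = j ∧ a = c ∧ b = d := by
  simp only [LexTriple, pmem_memV] at h1 h2
  rcases h1 with h1 | ⟨rfl, h1⟩
  · rcases h2 with h2 | ⟨rfl, h2⟩
    · exact absurd h1 h2.asymm
    · exact absurd h1 (lt_irrefl _)
  · replace h2 := (h2.resolve_left (lt_irrefl _)).2
    rcases h1 with ⟨h1, ne⟩ | ⟨rfl, h1⟩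
    · rcases h2 with ⟨h2, -⟩ | ⟨e, -⟩
      · exact absurd (h.antisymm h1 h2) ne
      · exact absurd e.symm ne
    · rcases h2 with ⟨-, ne⟩ | ⟨-, h2⟩
      · exact absurd rfl ne
      · exact ⟨rfl, rfl, h.antisymm h1 h2⟩

theorem exists_least_triple (h : WO fun x y => ZFSet.pair x y ∈ Q)
    {P : Fin 10 → ZFSet → ZFSet → Prop} (hne : ∃ i a b, P i a b)
    (hP : ∀ i a b, P i a b → ZFSet.pair a a ∈ Q ∧ ZFSet.pair b b ∈ Q) :
    ∃ i a b, P i a b ∧ ∀ j c d, P j c d → LexTriple memV Q i a b j c d := by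
  obtain ⟨i, hi, hmin⟩ : ∃ i, (∃ a b, P i a b) ∧ ∀ j, (∃ a b, P j a b) → i ≤ j := by
    obtain ⟨i, hi, hmin⟩ := WellFounded.has_min (wellFounded_lt (α := Fin 10)) {i | ∃ a b, P i a b} hne
    exact ⟨i, hi, fun j hj => not_lt.1 (hmin j hj)⟩
  obtain ⟨a, ⟨b', hb'⟩, ha⟩ := h.least (S := {a | ∃ b, P i a b}) hi
    (fun a ⟨b, hb⟩ => (hP _ _ _ hb).1)
  obtain ⟨b, hb, hbm⟩ := h.least (S := {b | P i a b}) ⟨b', hb'⟩ (fun b hb => (hP _ _ _ hb).2)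
  refine ⟨i, a, b, hb, fun j c d hj => ?_⟩
  simp only [LexTriple, pmem_memV]
  rcases (hmin j ⟨c, d, hj⟩).lt_or_eq with hlt | rfl
  · exact Or.inl hlt
  · refine Or.inr ⟨rfl, ?_⟩
    by_cases e : a = c
    · subst e
      exact Or.inr ⟨rfl, hbm d hj⟩
    · exact Or.inl ⟨ha c ⟨d, hj⟩, e⟩

theorem exists_lexLe (h : WO fun x y => ZFSet.pair x y ∈ Q) {S : Set ZFSet} (hne : S.Nonempty)
    (hS : ∀ x ∈ S, New memV Q x) : ∃ m ∈ S, ∀ y ∈ S, LexLe memV Q m y := by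
  obtain ⟨x, hx⟩ := hne
  obtain ⟨-, i, a, b, hr⟩ := hS x hx
  obtain ⟨i, a, b, ⟨m, hm, hr⟩, hmin⟩ := h.exists_least_triple
    (P := fun i a b => ∃ x ∈ S, OpRep memV Q i a b x) ⟨i, a, b, x, hx, hr⟩
    (fun i a b ⟨x, _, hr⟩ => ⟨pmem_memV.1 hr.1, pmem_memV.1 hr.2.1⟩)
  exact ⟨m, hm, fun y hy => ⟨i, a, b, hr, fun j c d hj => hmin j c d ⟨y, hy, hj⟩⟩⟩

theorem lexLe_refl (h : WO fun x y => ZFSet.pair x y ∈ Q) {x : ZFSet} (hx : New memV Q x) :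
    LexLe memV Q x x := by
  obtain ⟨m, rfl, hm⟩ := h.exists_lexLe (S := {x}) ⟨x, rfl⟩ (by rintro _ rfl; exact hx)
  exact hm _ rfl

theorem lexLe_antisymm (h : WO fun x y => ZFSet.pair x y ∈ Q) {x y : ZFSet}
    (h1 : LexLe memV Q x y) (h2 : LexLe memV Q y x) : x = y := by
  obtain ⟨i, a, b, hx, h1⟩ := h1
  obtain ⟨j, c, d, hy, h2⟩ := h2
  obtain ⟨rfl, rfl, rfl⟩ := h.lexTriple_antisymm (h1 _ _ _ hy) (h2 _ _ _ hx)
  ext z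
  exact (hx.2.2 z).trans (hy.2.2 z).symm

theorem nextLe_self (h : WO fun x y => ZFSet.pair x y ∈ Q) {x : ZFSet} :
    NextLe memV Q x x ↔ ZFSet.pair x x ∈ Q ∨ New memV Q x := by
  simp only [NextLe, pmem_memV]
  refine ⟨?_, ?_⟩
  · tauto
  · rintro (hx | hx)
    · exact Or.inl hx
    · exact Or.inr (Or.inr ⟨hx, hx, h.lexLe_refl hx⟩)

theorem next (h : WO fun x y => ZFSet.pair x y ∈ Q) : WO (NextLe memV Q) where
  fld := by
    intro x y hxy
    rw [h.nextLe_self, h.nextLe_self]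
    simp only [NextLe, pmem_memV] at hxy
    rcases hxy with hxy | hxy | hxy
    · exact ⟨Or.inl (h.fld hxy).1, Or.inl (h.fld hxy).2⟩
    · exact ⟨Or.inl hxy.1, Or.inr hxy.2⟩
    · exact ⟨Or.inr hxy.1, Or.inr hxy.2.1⟩
  antisymm := by
    intro x y hxy hyx
    have nw : ∀ {x}, New memV Q x → ¬ ZFSet.pair x x ∈ Q := fun hx => by
      simpa using hx.1
    simp only [NextLe, pmem_memV] at hxy hyx
    rcases hxy with hxy | hxy | hxy <;> rcases hyx with hyx | hyx | hyx
    · exact h.antisymm hxy hyx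
    · exact absurd (h.fld hxy).1 (nw hyx.2)
    · exact absurd (h.fld hxy).1 (nw hyx.2.1)
    · exact absurd (h.fld hyx).1 (nw hxy.2)
    · exact absurd hxy.1 (nw hyx.2)
    · exact absurd hxy.1 (nw hyx.2.1)
    · exact absurd (h.fld hyx).1 (nw hxy.2.1)
    · exact absurd hyx.1 (nw hxy.2.1)
    · exact h.lexLe_antisymm hxy.2.2 hyx.2.2
  least := by
    intro S hne hS
    simp only [h.nextLe_self] at hS
    by_cases hex : ∃ x ∈ S, ZFSet.pair x x ∈ Q
    · obtain ⟨m, hm, hmin⟩ := h.least (S := {x ∈ S | ZFSet.pair x x ∈ Q}) hex fun x hx => hx.2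
      refine ⟨m, hm.1, fun y hy => ?_⟩
      simp only [NextLe, pmem_memV]
      rcases hS y hy with hy' | hy'
      · exact Or.inl (hmin y ⟨hy, hy'⟩)
      · exact Or.inr (Or.inl ⟨hm.2, hy'⟩)
    · have hS' : ∀ x ∈ S, New memV Q x := fun x hx =>
        (hS x hx).resolve_left fun h => hex ⟨x, hx, h⟩
      obtain ⟨m, hm, hmin⟩ := h.exists_lexLe hne hS'
      exact ⟨m, hm, fun y hy => Or.inr (Or.inr ⟨hS' m hm, hS' y hy, hmin y hy⟩)⟩

end Next

end WO

/-- The `α`-th canonical order. -/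
def rle (α : Ordinal.{0}) (x y : ZFSet.{0}) : Prop := ZFSet.pair x y ∈ rset α

theorem rle_iff {α : Ordinal.{0}} {x y : ZFSet} :
    rle α x y ↔ (x = ∅ ∧ y = ∅) ∨ ∃ β < α, NextLe memV (rset β) x y := by
  unfold rle
  rw [mem_rset, ordBase_memV, ZFSet.pair_inj]
  refine or_congr_right (exists_congr fun β => and_congr_right fun _ => ?_)
  simp [OrdNext, ZFSet.pair_inj]

theorem rle_of_next {α β : Ordinal.{0}} (h : β < α) {x y : ZFSet}
    (hxy : NextLe memV (rset β) x y) : rle α x y :=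
  rle_iff.2 (Or.inr ⟨β, h, hxy⟩)

theorem rle_empty (α : Ordinal.{0}) : rle α ∅ ∅ := rle_iff.2 (Or.inl ⟨rfl, rfl⟩)

theorem rle_mono {α β : Ordinal.{0}} (h : β ≤ α) {x y : ZFSet} (hxy : rle β x y) : rle α x y := by
  rw [rle_iff] at hxy ⊢
  exact hxy.imp_right fun ⟨γ, hγ, hn⟩ => ⟨γ, hγ.trans_le h, hn⟩

theorem next_of_rle {α : Ordinal.{0}} {x y : ZFSet} (h : rle α x y) : NextLe memV (rset α) x y :=
  Or.inl (pmem_memV.2 h)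

theorem rle_of_next_of_fld {α : Ordinal.{0}} {x y : ZFSet} (h : NextLe memV (rset α) x y)
    (hy : rle α y y) : rle α x y := by
  have : ¬ New memV (rset α) y := fun hn => hn.1 (pmem_memV.2 hy)
  rcases h with h | h | h
  · exact pmem_memV.1 h
  · exact absurd h.2 this
  · exact absurd h.2.1 this

theorem rle_add_one {α : Ordinal.{0}} {x y : ZFSet} :
    rle (α + 1) x y ↔ NextLe memV (rset α) x y := by
  refine ⟨fun h => ?_, rle_of_next (lt_add_one α)⟩
  rcases rle_iff.1 h with ⟨rfl, rfl⟩ | ⟨β, hβ, hn⟩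
  · exact next_of_rle (rle_empty α)
  · rcases (Order.lt_add_one_iff.1 hβ).lt_or_eq with hβ | rfl
    · exact next_of_rle (rle_of_next hβ hn)
    · assumption

/-- Later orders are end-extensions of earlier ones. -/
theorem rle_of_fld {α β : Ordinal.{0}} (h : β ≤ α) {x y : ZFSet} (hxy : rle α x y)
    (hy : rle β y y) : rle β x y := by
  induction α using WellFoundedLT.induction with
  | ind α ih =>
    rcases rle_iff.1 hxy with ⟨rfl, rfl⟩ | ⟨γ, hγ, hn⟩
    · exact rle_empty β
    · rcases lt_or_ge γ β with hγβ | hγβ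
      · exact rle_of_next hγβ hn
      · exact ih γ hγ hγβ (rle_of_next_of_fld hn (rle_mono hγβ hy))

theorem rle_zero {x y : ZFSet} : rle 0 x y ↔ x = ∅ ∧ y = ∅ := by
  simp [rle_iff]

/-- New elements come after the old ones. -/
theorem rle_of_not_fld {α β : Ordinal.{0}} (h : β ≤ α) {x y : ZFSet} (hx : rle β x x)
    (hy : rle α y y) (hy' : ¬ rle β y y) : rle α x y := by
  induction α using WellFoundedLT.induction with
  | ind α ih =>
    rcases rle_iff.1 hy with ⟨rfl, -⟩ | ⟨γ, hγ, hn⟩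
    · exact absurd (rle_empty β) hy'
    · rcases lt_or_ge γ β with hγβ | hγβ
      · exact absurd (rle_of_next hγβ hn) hy'
      · by_cases hyγ : rle γ y y
        · exact rle_mono hγ.le (ih γ hγ hγβ hyγ)
        · have hnew : New memV (rset γ) y := by
            rcases hn with hn | hn | hn
            · exact absurd (pmem_memV.1 hn) hyγ
            · exact hn.2
            · exact hn.1
          exact rle_of_next hγ (Or.inr (Or.inl ⟨pmem_memV.2 (rle_mono hγβ hx), hnew⟩))

theorem wo_rle (α : Ordinal.{0}) : WO (rle α) := by
  induction α using WellFoundedLT.induction with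
  | ind α ih =>
    have ihn : ∀ β < α, WO (NextLe memV (rset β)) := fun β hβ => (ih β hβ).next
    refine ⟨?_, ?_, ?_⟩
    · intro x y hxy
      rcases rle_iff.1 hxy with ⟨rfl, rfl⟩ | ⟨γ, hγ, hn⟩
      · exact ⟨hxy, hxy⟩
      · have := (ihn γ hγ).fld hn
        exact ⟨rle_of_next hγ this.1, rle_of_next hγ this.2⟩
    · intro x y hxy hyx
      rcases rle_iff.1 hxy with ⟨rfl, rfl⟩ | ⟨γ, hγ, hn⟩
      · rfl
      rcases rle_iff.1 hyx with ⟨rfl, rfl⟩ | ⟨δ, hδ, hn'⟩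
      · rfl
      refine (ihn (max γ δ) (max_lt hγ hδ)).antisymm ?_ ?_
      · exact rle_add_one.1 (rle_mono (by gcongr; exact le_max_left _ _) (rle_add_one.2 hn))
      · exact rle_add_one.1 (rle_mono (by gcongr; exact le_max_right _ _) (rle_add_one.2 hn'))
    · rintro S ⟨x, hx⟩ hS
      by_cases h0 : (∅ : ZFSet) ∈ S
      · refine ⟨∅, h0, fun y hy => ?_⟩
        by_cases hy0 : y = ∅
        · rw [hy0]
          exact rle_empty α
        · exact rle_of_not_fld bot_le (rle_empty 0) (hS y hy) fun h =>
            hy0 (rle_zero.1 h).1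
      · rcases rle_iff.1 (hS x hx) with ⟨rfl, -⟩ | ⟨γ, hγ, hn⟩
        · exact absurd hx h0
        obtain ⟨m, hm, hmin⟩ := (ihn γ hγ).least (S := {x ∈ S | NextLe memV (rset γ) x x})
          ⟨x, hx, hn⟩ fun x hx => hx.2
        refine ⟨m, hm.1, fun y hy => ?_⟩
        by_cases hy' : NextLe memV (rset γ) y y
        · exact rle_of_next hγ (hmin y ⟨hy, hy'⟩)
        · exact rle_of_not_fld (Order.add_one_le_of_lt hγ) (rle_add_one.2 hm.2) (hS y hy) fun h =>
            hy' (rle_add_one.1 h)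

/-- The field of the `α`-th canonical order. -/
noncomputable def xset (α : Ordinal.{0}) : ZFSet.{0} :=
  (rset α).sUnion.sUnion.sep fun x => ZFSet.pair x x ∈ rset α

theorem mem_xset {α : Ordinal.{0}} {x : ZFSet} : x ∈ xset α ↔ rle α x x := by
  unfold xset rle
  rw [ZFSet.mem_sep]
  exact ⟨fun h => h.2, fun h => ⟨(mem_sUnion_of_pmem h).1, h⟩⟩

theorem mem_xset_iff {α : Ordinal.{0}} {x : ZFSet} :
    x ∈ xset α ↔ x = ∅ ∨ ∃ β < α, x ∈ xset β ∨ New memV (rset β) x := by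
  rw [mem_xset, rle_iff, and_self]
  refine or_congr_right (exists_congr fun β => and_congr_right fun _ => ?_)
  rw [(wo_rle β).nextLe_self, mem_xset, rle]

theorem xset_mono {α β : Ordinal.{0}} (h : α ≤ β) {x : ZFSet} (hx : x ∈ xset α) : x ∈ xset β := by
  rw [mem_xset] at hx ⊢
  exact rle_mono h hx

theorem empty_mem_xset (α : Ordinal.{0}) : ∅ ∈ xset α := mem_xset.2 (rle_empty α)

theorem xset_trans {α : Ordinal.{0}} {x z : ZFSet} (hx : x ∈ xset α) (hz : z ∈ x) : z ∈ xset α := by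
  induction α using WellFoundedLT.induction with
  | ind α ih =>
    rcases mem_xset_iff.1 hx with rfl | ⟨β, hβ, hx | hx⟩
    · simp at hz
    · exact xset_mono hβ.le (ih β hβ hx)
    · obtain ⟨-, i, a, b, hr⟩ := hx
      exact xset_mono hβ.le (mem_xset.2 (pmem_memV.1 ((hr.2.2 z).1 hz).1))

theorem mem_xset_add_one {α : Ordinal.{0}} {i : Fin 10} {a b y : ZFSet} (ha : a ∈ xset α)
    (hb : b ∈ xset α) (hy : ∀ z, z ∈ y ↔ z ∈ xset α ∧ Op memV i a b z) : y ∈ xset (α + 1) := by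
  by_cases h : y ∈ xset α
  · exact xset_mono le_self_add h
  · refine mem_xset_iff.2 (Or.inr ⟨α, lt_add_one α, Or.inr ⟨?_, i, a, b, ?_, ?_, ?_⟩⟩)
    · rwa [pmem_memV, ← rle, ← mem_xset]
    · rwa [pmem_memV, ← rle, ← mem_xset]
    · rwa [pmem_memV, ← rle, ← mem_xset]
    · intro z
      rw [pmem_memV, ← rle, ← mem_xset]
      exact hy z

theorem xset_mem_xset {α β : Ordinal.{0}} : xset β ∈ xset α ↔ β < α := by
  refine ⟨fun h => ?_, fun h => ?_⟩
  · by_contra hlt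
    exact ZFSet.mem_irrefl _ (xset_mono (not_lt.1 hlt) h)
  · refine xset_mono (Order.add_one_le_of_lt h) (mem_xset_add_one (i := 0) (empty_mem_xset β)
      (empty_mem_xset β) fun z => ?_)
    simp [Op]

theorem countable_xset {α : Ordinal.{0}} (h : α < Ordinal.omega 1) :
    (xset α : Set ZFSet).Countable := by
  induction α using WellFoundedLT.induction with
  | ind α ih =>
    have hsub : (xset α : Set ZFSet) ⊆ {∅} ∪ ⋃ β ∈ Set.Iio α,
        ((xset β : Set ZFSet) ∪ ⋃ i : Fin 10, ⋃ a ∈ (xset β : Set ZFSet),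
          ⋃ b ∈ (xset β : Set ZFSet), {(xset β).sep (Op memV i a b)}) := by
      intro x hx
      rcases mem_xset_iff.1 hx with rfl | ⟨β, hβ, hx | hx⟩
      · exact Or.inl rfl
      · exact Or.inr (Set.mem_biUnion hβ (Or.inl hx))
      · refine Or.inr (Set.mem_biUnion hβ (Or.inr ?_))
        obtain ⟨-, i, a, b, ha, hb, hr⟩ := hx
        rw [pmem_memV, ← rle, ← mem_xset] at ha hb
        refine Set.mem_iUnion.2 ⟨i, Set.mem_biUnion ha (Set.mem_biUnion hb ?_)⟩
        rw [Set.mem_singleton_iff]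
        ext z
        refine (hr z).trans ?_
        rw [ZFSet.mem_sep, pmem_memV, mem_xset, rle]
    refine Set.Countable.mono hsub ((Set.countable_singleton _).union
      ((countable_Iio h).biUnion fun β hβ => ?_))
    have hβ := ih β hβ (lt_trans hβ h)
    exact hβ.union (Set.countable_iUnion fun i => hβ.biUnion fun a _ => hβ.biUnion fun b _ =>
      Set.countable_singleton _)

theorem exists_pair_of_mem_rset {α : Ordinal.{0}} {p : ZFSet} (hp : p ∈ rset α) :
    ∃ x y, p = ZFSet.pair x y := by
  rcases mem_rset.1 hp with h | ⟨β, -, x, y, h, -⟩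
  · exact ⟨∅, ∅, ordBase_memV.1 h⟩
  · exact ⟨x, y, isPair_memV.1 h⟩

theorem countable_rset {α : Ordinal.{0}} (h : α < Ordinal.omega 1) :
    (rset α : Set ZFSet).Countable := by
  have hc := countable_xset h
  refine ((hc.prod hc).image fun q => ZFSet.pair q.1 q.2).mono fun p hp => ?_
  obtain ⟨x, y, rfl⟩ := exists_pair_of_mem_rset hp
  have := (wo_rle α).fld (show rle α x y from hp)
  exact ⟨(x, y), ⟨mem_xset.2 this.1, mem_xset.2 this.2⟩, rfl⟩

theorem exists_lt_mem_xset {α : Ordinal.{0}} (hα : Order.IsSuccLimit α) {x : ZFSet}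
    (hx : x ∈ xset α) : ∃ β < α, x ∈ xset β := by
  rw [mem_xset] at hx
  rcases rle_iff.1 hx with ⟨rfl, -⟩ | ⟨β, hβ, hn⟩
  · exact ⟨0, hα.bot_lt, empty_mem_xset 0⟩
  · exact ⟨β + 1, hα.succ_lt hβ, mem_xset.2 (rle_add_one.2 hn)⟩

theorem transPair_xset {α : Ordinal.{0}} (hα : Order.IsSuccLimit α) :
    TransPair (xset α : Set ZFSet) := by
  refine ⟨fun hx hz => xset_trans hx hz, fun {x y} hx hy => ?_⟩
  obtain ⟨β, hβ, hx⟩ := exists_lt_mem_xset hα hx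
  obtain ⟨γ, hγ, hy⟩ := exists_lt_mem_xset hα hy
  have hx' := xset_mono (le_max_left β γ) hx
  have hy' := xset_mono (le_max_right β γ) hy
  refine xset_mono (Order.add_one_le_of_lt (hα.succ_lt (max_lt hβ hγ)))
    (xset_mono le_self_add (mem_xset_add_one (i := 1) hx' hy' fun z => ?_))
  simp only [ZFSet.mem_pair, Op]
  exact ⟨fun h => ⟨by rcases h with rfl | rfl <;> assumption, h⟩, fun h => h.2⟩

theorem ordTag_rset {α β : Ordinal.{0}} : OrdTag memV (rset β) (rset α) ↔ β < α := by
  rw [← xset_mem_xset]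
  simp only [OrdTag, pmem_memV, memV]
  constructor
  · rintro ⟨d, hd, h⟩
    have : d = xset β := by
      ext x
      rw [hd, mem_xset, rle]
    rwa [← this, mem_xset]
  · exact fun h => ⟨xset β, fun x => by rw [mem_xset, rle], by rwa [mem_xset] at h⟩

/-! ### Towers of countable sets closed under definability -/

instance : Countable memLang.Symbols := by
  have (l : ℕ) : Countable (memLang.Functions l) := inferInstanceAs (Countable Empty)
  have : Countable (Σ l, memLang.Relations l) := by
    have (l : ℕ) : Countable (memLang.Relations l) :=
      inferInstanceAs (Countable (PLift (l = 2)))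
    infer_instance
  exact inferInstanceAs (Countable (_ ⊕ _))

/-- `K` is the union of the continuous increasing sequence `S` of countable transitive sets of
length `ω₁`, and contains all subsets definable over its members. -/
structure Tower (S : Ordinal.{0} → ZFSet.{0}) (K : Set ZFSet.{0}) : Prop where
  mem_iff : ∀ {x}, x ∈ K ↔ ∃ α < Ordinal.omega 1, x ∈ S α
  mono : ∀ {α β x}, α ≤ β → x ∈ S α → x ∈ S β
  trans : ∀ {α x z}, x ∈ S α → z ∈ x → z ∈ S α
  countable : ∀ {α}, α < Ordinal.omega 1 → (S α : Set ZFSet).Countable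
  cont : ∀ {α x}, Order.IsSuccLimit α → x ∈ S α → ∃ β < α, x ∈ S β
  fodef : ∀ {α} {x : ZFSet}, α < Ordinal.omega 1 → FODef (S α : Set ZFSet) (x : Set ZFSet) → x ∈ K

namespace Tower

variable {S : Ordinal.{0} → ZFSet.{0}} {K : Set ZFSet.{0}}

theorem subset (h : Tower S K) {α : Ordinal.{0}} (hα : α < Ordinal.omega 1) :
    (S α : Set ZFSet) ⊆ K := fun _ hx => h.mem_iff.2 ⟨α, hα, hx⟩

theorem exists_stage (h : Tower S K) {Z : Set ZFSet} (hZ : Z.Countable) (hK : Z ⊆ K) :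
    ∃ α < Ordinal.omega 1, ∀ x ∈ Z, x ∈ S α :=
  hZ.exists_stage (P := fun α x => x ∈ S α) h.mono fun _ hx => h.mem_iff.1 (hK hx)

theorem exists_witness_stage (h : Tower S K) {α : Ordinal.{0}} (hα : α < Ordinal.omega 1) :
    ∃ β < Ordinal.omega 1, α < β ∧ ∀ (n : ℕ) (φ : memLang.BoundedFormula Empty (n + 1))
      (x : Fin n → ↥K) (a : ↥K), (∀ i, (x i : ZFSet) ∈ S α) →
      (let _ := memStruc K; φ.Realize default (Fin.snoc x a : Fin (n + 1) → ↥K)) →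
      ∃ b : ↥K, (b : ZFSet) ∈ S β ∧
        (let _ := memStruc K; φ.Realize default (Fin.snoc x b : Fin (n + 1) → ↥K)) := by
  let _ := memStruc K
  have := (h.countable hα).to_subtype
  let I := Σ n : ℕ, memLang.BoundedFormula Empty (n + 1) × (Fin n → (S α : Set ZFSet))
  let inc : ↥(S α : Set ZFSet) → ↥K := Set.inclusion (h.subset hα)
  have (n : ℕ) : Countable (memLang.BoundedFormula Empty (n + 1)) :=
    (sigma_mk_injective (β := memLang.BoundedFormula Empty)).countable
  have : Countable I := inferInstanceAs (Countable (Σ _, _))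
  have key : ∀ t : I, ∃ γ < Ordinal.omega 1, ∀ a : ↥K,
      t.2.1.Realize default (Fin.snoc (inc ∘ t.2.2) a : Fin (t.1 + 1) → ↥K) →
      ∃ b : ↥K, (b : ZFSet) ∈ S γ ∧
        t.2.1.Realize default (Fin.snoc (inc ∘ t.2.2) b : Fin (t.1 + 1) → ↥K) := by
    intro t
    by_cases hex : ∃ a : ↥K, t.2.1.Realize default (Fin.snoc (inc ∘ t.2.2) a : Fin (t.1 + 1) → ↥K)
    · obtain ⟨b, hb⟩ := hex
      obtain ⟨γ, hγ, hbγ⟩ := h.mem_iff.1 b.2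
      exact ⟨γ, hγ, fun a _ => ⟨b, hbγ, hb⟩⟩
    · exact ⟨0, isSuccLimit_omega_one.bot_lt, fun a ha => absurd ⟨a, ha⟩ hex⟩
  choose f hf hw using key
  obtain ⟨β, hβ, hlt⟩ := exists_lt_omega_one hf
  refine ⟨max β (α + 1), max_lt hβ (add_one_lt_omega_one hα),
    lt_max_of_lt_right (lt_add_one α), fun n φ x a hx hr => ?_⟩
  obtain ⟨b, hb, hr⟩ := hw ⟨n, φ, fun i => ⟨x i, hx i⟩⟩ a hr
  exact ⟨b, h.mono ((hlt _).le.trans (le_max_left _ _)) hb, hr⟩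

theorem exists_elementary (h : Tower S K) {α : Ordinal.{0}} (hα : α < Ordinal.omega 1) :
    ∃ β < Ordinal.omega 1, α ≤ β ∧ ∃ hs : (S β : Set ZFSet) ⊆ K, ∀ (n : ℕ)
      (φ : memLang.Formula (Fin n)) (x : Fin n → (S β : Set ZFSet)),
      (let _ := memStruc K; φ.Realize (fun i => Set.inclusion hs (x i))) ↔
        (let _ := memStruc (S β : Set ZFSet); φ.Realize x) := by
  choose! g hg hlt hw using fun (α : Ordinal.{0}) (hα : α < Ordinal.omega 1) =>
    h.exists_witness_stage hα
  let f : ℕ → Ordinal.{0} := fun n => Nat.rec α (fun _ => g) n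
  have hf : ∀ n, f n < Ordinal.omega 1 := fun n => by
    induction n with
    | zero => exact hα
    | succ n ih => exact hg _ ih
  have hmono : StrictMono f := strictMono_nat_of_lt_succ fun n => hlt _ (hf n)
  have hle : ∀ n, f n ≤ ⨆ n, f n := fun n => Ordinal.le_iSup f n
  have hβ : ⨆ n, f n < Ordinal.omega 1 := by
    obtain ⟨γ, hγ, h⟩ := exists_lt_omega_one hf
    exact (Ordinal.iSup_le fun n => (h n).le).trans_lt hγ
  have hltβ : ∀ n, f n < ⨆ n, f n := fun n => (hmono (Nat.lt_succ_self n)).trans_le (hle n.succ)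
  have hlim : Order.IsSuccLimit (⨆ n, f n) := by
    refine ⟨fun hmin => ?_, fun γ hγ => ?_⟩
    · exact not_lt_bot ((hltβ 0).trans_le (hmin bot_le))
    · obtain ⟨n, hn⟩ := (Ordinal.lt_iSup_iff).1 hγ.lt
      exact hγ.2 hn (hltβ n)
  refine ⟨⨆ n, f n, hβ, hle 0, h.subset hβ, ?_⟩
  intro n φ x
  let _ := memStruc K
  let _ := memStruc (S (⨆ n, f n) : Set ZFSet)
  let e : (S (⨆ n, f n) : Set ZFSet) ↪[memLang] ↥K :=
    { toFun := Set.inclusion (h.subset hβ)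
      inj' := Set.inclusion_injective _
      map_fun' := fun f => Empty.elim f
      map_rel' := fun r x => Iff.rfl }
  refine e.isElementary_of_exists ?_ φ x
  intro n φ x a hr
  have hx : ∀ i, ∃ k, (x i : ZFSet) ∈ S (f k) := fun i => by
    obtain ⟨γ, hγ, hx⟩ := h.cont hlim (x i).2
    obtain ⟨k, hk⟩ := (Ordinal.lt_iSup_iff).1 hγ
    exact ⟨k, h.mono hk.le hx⟩
  choose k hk using hx
  obtain ⟨b, hb, hr'⟩ := hw (f (Finset.univ.sup k)) (hf _) n φ (e ∘ x) a
    (fun i => h.mono (hmono.monotone (Finset.le_sup (Finset.mem_univ i))) (hk i)) hr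
  exact ⟨⟨b, h.mono (hle (Finset.univ.sup k + 1)) hb⟩, hr'⟩

/-- A countable subset of `K` definable over `K` with parameters is an element of `K`. -/
theorem mem_of_udef (h : Tower S K) {n : ℕ}
    {P : ∀ (A : Type 1), (A → A → Prop) → (Fin n → A) → A → Prop}
    (hP : UDef (ι := Option (Fin n)) fun A E w => P A E (fun i => w (some i)) (w none))
    (a : Fin n → ↥K) (hc : {b : ↥K | P ↥K (memOn K) a b}.Countable) :
    ∃ x ∈ K, ∀ z, z ∈ x ↔ ∃ hz : z ∈ K, P ↥K (memOn K) a ⟨z, hz⟩ := by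
  obtain ⟨φ, hφ⟩ := hP.reindex (fun o : Option (Fin n) => o.elim (Fin.last n) Fin.castSucc)
  obtain ⟨α, hα, hsub⟩ := h.exists_stage
    (Z := Subtype.val '' ({b : ↥K | P ↥K (memOn K) a b} ∪ Set.range a))
    ((hc.union (Set.countable_range a)).image _) (by rintro _ ⟨b, -, rfl⟩; exact b.2)
  obtain ⟨β, hβ, hle, hs, he⟩ := h.exists_elementary hα
  have hZ : ∀ z (hz : z ∈ K), P ↥K (memOn K) a ⟨z, hz⟩ → z ∈ S β := fun z hz hp =>
    h.mono hle (hsub z ⟨⟨z, hz⟩, Or.inl hp, rfl⟩)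
  have ha : ∀ i, (a i : ZFSet) ∈ S β := fun i =>
    h.mono hle (hsub _ ⟨a i, Or.inr ⟨i, rfl⟩, rfl⟩)
  let x := (S β).sep fun z => ∃ hz : z ∈ K, P ↥K (memOn K) a ⟨z, hz⟩
  have hx : ∀ z, z ∈ x ↔ ∃ hz : z ∈ K, P ↥K (memOn K) a ⟨z, hz⟩ := fun z => by
    simp only [x, ZFSet.mem_sep]
    exact ⟨fun hz => hz.2, fun hz => ⟨hZ z hz.1 hz.2, hz⟩⟩
  refine ⟨x, h.fodef hβ ?_, hx⟩
  refine ⟨fun z hz => ((ZFSet.mem_sep.1 hz).1), n, φ, fun i => ⟨a i, ha i⟩, ?_⟩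
  ext z
  rw [SetLike.mem_coe, hx]
  have heq : ∀ hz : z ∈ S β, (let _ := memStruc (S β : Set ZFSet)
      φ.Realize (Fin.snoc (fun i => (⟨a i, ha i⟩ : ↥(S β : Set ZFSet))) ⟨z, hz⟩)) ↔
        P ↥K (memOn K) a ⟨z, hs hz⟩ := by
    intro hz
    rw [← he]
    refine (hφ ↥K (memOn K) _).trans ?_
    simp only [Option.elim, Fin.snoc_castSucc, Fin.snoc_last]
  exact ⟨fun ⟨hz, hp⟩ => ⟨hZ z hz hp, (heq _).2 hp⟩, fun ⟨hz, hp⟩ => ⟨hs hz, (heq hz).1 hp⟩⟩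

theorem transPair (h : Tower S K) : TransPair K := by
  refine ⟨fun {x z} hx hz => ?_, fun {x y} hx hy => ?_⟩
  · obtain ⟨α, hα, hx⟩ := h.mem_iff.1 hx
    exact h.mem_iff.2 ⟨α, hα, h.trans hx hz⟩
  · obtain ⟨p, hp, hmem⟩ := h.mem_of_udef (P := fun A E a z => z = a 0 ∨ z = a 1)
      ((UDef.eq _ _).or (UDef.eq _ _)) ![⟨x, hx⟩, ⟨y, hy⟩]
      ((Set.Countable.insert _ (Set.countable_singleton _)).mono fun _ hz => hz)
    convert hp
    ext z
    rw [hmem, ZFSet.mem_pair]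
    simp only [Subtype.ext_iff, Matrix.cons_val_zero, Matrix.cons_val_one]
    refine ⟨fun hz => ⟨by rcases hz with rfl | rfl <;> assumption, hz⟩, fun hz => hz.2⟩

theorem countable_of_mem (h : Tower S K) {x : ZFSet} (hx : x ∈ K) : (x : Set ZFSet).Countable := by
  obtain ⟨α, hα, hx⟩ := h.mem_iff.1 hx
  exact (h.countable hα).mono fun z hz => h.trans hx hz

theorem empty_mem (h : Tower S K) : (∅ : ZFSet) ∈ K := by
  obtain ⟨p, hp, hmem⟩ := h.mem_of_udef (n := 0) (P := fun A E a z => False)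
    (UDef.const _) ![] (by simp)
  convert hp
  exact ((ZFSet.eq_empty p).2 fun z hz => ((hmem z).1 hz).2).symm

end Tower

/-! ### The constructible tower -/

theorem countable_fodef {Y : ZFSet.{0}} (hY : (Y : Set ZFSet).Countable) :
    {x : ZFSet | FODef (Y : Set ZFSet) (x : Set ZFSet)}.Countable := by
  have := hY.to_subtype
  have hsub : {x : ZFSet | FODef (Y : Set ZFSet) (x : Set ZFSet)} ⊆
      ⋃ n : ℕ, ⋃ φ : memLang.Formula (Fin (n + 1)), ⋃ a : Fin n → ↥(Y : Set ZFSet),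
        {x | (x : Set ZFSet) = {b | ∃ hb : b ∈ (Y : Set ZFSet),
          let _ := memStruc (Y : Set ZFSet)
          φ.Realize (Fin.snoc a ⟨b, hb⟩)}} := by
    rintro x ⟨-, n, φ, a, h⟩
    exact Set.mem_iUnion.2 ⟨n, Set.mem_iUnion.2 ⟨φ, Set.mem_iUnion.2 ⟨a, h⟩⟩⟩
  refine Set.Countable.mono hsub (Set.countable_iUnion fun n => Set.countable_iUnion fun φ =>
    Set.countable_iUnion fun a => Set.Subsingleton.countable fun x hx y hy =>
      SetLike.coe_injective (hx.trans hy.symm))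

theorem countable_lset {α : Ordinal.{0}} (h : α < Ordinal.omega 1) :
    (lset α : Set ZFSet).Countable := by
  induction α using WellFoundedLT.induction with
  | ind α ih =>
    have hsub : (lset α : Set ZFSet) ⊆ ⋃ β ∈ Set.Iio α,
        {x : ZFSet | FODef (lset β : Set ZFSet) (x : Set ZFSet)} := by
      intro x hx
      obtain ⟨β, hβ, hx⟩ := mem_lset.1 hx
      exact Set.mem_biUnion hβ hx
    exact Set.Countable.mono hsub ((countable_Iio h).biUnion fun β hβ =>
      countable_fodef (ih β hβ (lt_trans hβ h)))

theorem tower_lset : Tower lset LOmega1 where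
  mem_iff := mem_LOmega1
  mono := fun h hx => lset_mono h hx
  trans := lset_trans
  countable := countable_lset
  cont := fun {α x} hα hx => by
    obtain ⟨β, hβ, hx⟩ := mem_lset.1 hx
    exact ⟨β + 1, hα.succ_lt hβ, mem_lset_add_one.2 hx⟩
  fodef := fun {α x} hα hx =>
    mem_LOmega1.2 ⟨α + 1, add_one_lt_omega_one hα, mem_lset_add_one.2 hx⟩

/-! ### Definable relations coded by sets of tuples -/

/-- The set coding a finite sequence. -/
noncomputable def tup {M : Set ZFSet.{0}} : ∀ {k : ℕ}, (Fin k → ↥M) → ZFSet.{0}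
  | 0, _ => ∅
  | _ + 1, v => ZFSet.pair (tup (Fin.init v)) (v (Fin.last _))

section Tuples

variable {M : Set ZFSet.{0}} {k : ℕ}

theorem tup_zero (v : Fin 0 → ↥M) : tup v = ∅ := rfl

theorem tup_succ (v : Fin (k + 1) → ↥M) :
    tup v = ZFSet.pair (tup (Fin.init v)) (v (Fin.last _)) := rfl

theorem tup_snoc (v : Fin k → ↥M) (a : ↥M) :
    tup (Fin.snoc v a : Fin (k + 1) → ↥M) = ZFSet.pair (tup v) a := by
  rw [tup_succ, Fin.init_snoc, Fin.snoc_last]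

theorem pair_ne_empty (x y : ZFSet.{0}) : ZFSet.pair x y ≠ ∅ := fun h =>
  ZFSet.notMem_empty {x} (h ▸ by simp [ZFSet.pair])

theorem tup_length : ∀ {k l : ℕ} {v : Fin k → ↥M} {w : Fin l → ↥M}, tup v = tup w → k = l
  | 0, 0, _, _, _ => rfl
  | 0, _ + 1, _, _, h => absurd h.symm (pair_ne_empty _ _)
  | _ + 1, 0, _, _, h => absurd h (pair_ne_empty _ _)
  | _ + 1, _ + 1, _, _, h => congrArg (· + 1) (tup_length (ZFSet.pair_inj.1 h).1)

theorem tup_injective : ∀ {k : ℕ}, Function.Injective (tup : (Fin k → ↥M) → ZFSet)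
  | 0, _, _, _ => Subsingleton.elim _ _
  | k + 1, v, w, h => by
    have h := ZFSet.pair_inj.1 h
    rw [← Fin.snoc_init_self v, ← Fin.snoc_init_self w, tup_injective h.1, Subtype.ext h.2]

theorem pair_mem_tup_image {S : Set (Fin (k + 1) → ↥M)} {s x : ZFSet} :
    ZFSet.pair s x ∈ tup '' S ↔ ∃ v a, (Fin.snoc v a : Fin (k + 1) → ↥M) ∈ S ∧ tup v = s ∧ ↑a = x := by
  constructor
  · rintro ⟨v, hv, h⟩
    have h := ZFSet.pair_inj.1 h
    exact ⟨_, _, by rwa [Fin.snoc_init_self], h.1, h.2⟩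
  · rintro ⟨v, a, h, rfl, rfl⟩
    exact ⟨_, h, tup_snoc _ _⟩

theorem mem_tup_image_succ {S : Set (Fin (k + 1) → ↥M)} {z : ZFSet} :
    z ∈ tup '' S ↔ ∃ v a, (Fin.snoc v a : Fin (k + 1) → ↥M) ∈ S ∧ z = ZFSet.pair (tup v) a := by
  constructor
  · rintro ⟨v, hv, rfl⟩
    exact ⟨_, _, by rwa [Fin.snoc_init_self], rfl⟩
  · rintro ⟨v, a, h, rfl⟩
    exact ⟨_, h, tup_snoc _ _⟩

theorem pair_notMem_tup_image_zero {S : Set (Fin 0 → ↥M)} {s x : ZFSet} :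
    ZFSet.pair s x ∉ tup '' S := by
  rintro ⟨v, -, h⟩
  exact pair_ne_empty _ _ h.symm

end Tuples

section Ops

variable {X A : ZFSet.{0}} {k : ℕ}

theorem op_diff {A' : ZFSet.{0}} {S S' : Set (Fin k → ↥(X : Set ZFSet))}
    (hA : ∀ z, z ∈ A ↔ z ∈ tup '' S) (hA' : ∀ z, z ∈ A' ↔ z ∈ tup '' S') (z : ZFSet) :
    Op memV 3 A A' z ↔ z ∈ tup '' (S \ S') := by
  rw [Set.image_sdiff tup_injective, Set.mem_sdiff]
  simp [Op, memV, hA, hA']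

theorem op_diff_of_ne {l : ℕ} (hkl : k ≠ l) {A' : ZFSet.{0}} {S : Set (Fin k → ↥(X : Set ZFSet))}
    {S' : Set (Fin l → ↥(X : Set ZFSet))}
    (hA : ∀ z, z ∈ A ↔ z ∈ tup '' S) (hA' : ∀ z, z ∈ A' ↔ z ∈ tup '' S') (z : ZFSet) :
    Op memV 3 A A' z ↔ z ∈ tup '' S := by
  simp only [Op, memV, hA, hA', and_iff_left_iff_imp]
  rintro ⟨v, -, rfl⟩ ⟨w, -, h⟩
  exact hkl (tup_length h).symm

theorem op_prod {S : Set (Fin k → ↥(X : Set ZFSet))} (hA : ∀ z, z ∈ A ↔ z ∈ tup '' S) (z : ZFSet) :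
    Op memV 4 A X z ↔
      z ∈ tup '' {v : Fin (k + 1) → ↥(X : Set ZFSet) | (fun i => v i.castSucc) ∈ S} := by
  simp only [Op, memV, hA, isPair_memV, mem_tup_image_succ, Set.mem_ofPred_eq, Fin.snoc_castSucc]
  constructor
  · rintro ⟨_, y, ⟨v, hv, rfl⟩, hy, rfl⟩
    exact ⟨v, ⟨y, hy⟩, hv, rfl⟩
  · rintro ⟨v, a, hv, rfl⟩
    exact ⟨_, _, ⟨v, hv, rfl⟩, a.2, rfl⟩

theorem op_dom_zero {S : Set (Fin 0 → ↥(X : Set ZFSet))} (hA : ∀ z, z ∈ A ↔ z ∈ tup '' S)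
    (z : ZFSet) : ¬ Op memV 5 A X z := by
  simp only [Op, pmem_memV, hA, not_exists]
  exact fun y => pair_notMem_tup_image_zero

theorem op_dom {S : Set (Fin (k + 1) → ↥(X : Set ZFSet))} (hA : ∀ z, z ∈ A ↔ z ∈ tup '' S)
    (z : ZFSet) : Op memV 5 A X z ↔
      z ∈ tup '' {v : Fin k → ↥(X : Set ZFSet) | ∃ a, (Fin.snoc v a : Fin (k + 1) → _) ∈ S} := by
  simp only [Op, pmem_memV, hA, pair_mem_tup_image]
  constructor
  · rintro ⟨y, v, a, h, rfl, -⟩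
    exact ⟨v, ⟨a, h⟩, rfl⟩
  · rintro ⟨v, ⟨a, h⟩, rfl⟩
    exact ⟨a, v, a, h, rfl, rfl⟩

theorem op_rel {i : Fin 10} {R : ZFSet → ZFSet → Prop}
    (hi : ∀ a b z, Op memV i a b z ↔ ∃ s x y, s ∈ a ∧ x ∈ b ∧ y ∈ b ∧
      z = ZFSet.pair (ZFSet.pair s x) y ∧ R x y)
    {S : Set (Fin k → ↥(X : Set ZFSet))} (hA : ∀ z, z ∈ A ↔ z ∈ tup '' S) (z : ZFSet) :
    Op memV i A X z ↔ z ∈ tup '' {v : Fin (k + 2) → ↥(X : Set ZFSet) |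
      (fun i => v i.castSucc.castSucc) ∈ S ∧ R (v (Fin.last k).castSucc) (v (Fin.last (k + 1)))} := by
  simp only [hi, hA, mem_tup_image_succ, Set.mem_ofPred_eq, Fin.snoc_castSucc, Fin.snoc_last]
  constructor
  · rintro ⟨_, x, y, ⟨v, hv, rfl⟩, hx, hy, rfl, h⟩
    refine ⟨Fin.snoc v ⟨x, hx⟩, ⟨y, hy⟩, ?_, ?_⟩
    · simpa using ⟨hv, h⟩
    · rw [tup_snoc]
  · rintro ⟨v, a, ⟨hv, h⟩, rfl⟩
    exact ⟨_, _, _, ⟨_, hv, rfl⟩, (v (Fin.last k)).2, a.2, by rw [tup_succ v]; rfl, h⟩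

theorem op_insert_zero {S : Set (Fin 0 → ↥(X : Set ZFSet))} (hA : ∀ z, z ∈ A ↔ z ∈ tup '' S)
    (z : ZFSet) : ¬ Op memV 9 A X z := by
  simp only [Op, pmem_memV, hA]
  rintro ⟨s, x, y, h, -⟩
  exact pair_notMem_tup_image_zero h

theorem op_insert {S : Set (Fin (k + 1) → ↥(X : Set ZFSet))} (hA : ∀ z, z ∈ A ↔ z ∈ tup '' S)
    (z : ZFSet) : Op memV 9 A X z ↔ z ∈ tup '' {v : Fin (k + 2) → ↥(X : Set ZFSet) |
      (fun i => v (Fin.lastCases (Fin.last _) (fun j => j.castSucc.castSucc) i)) ∈ S} := by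
  have e : ∀ (v : Fin (k + 1) → ↥(X : Set ZFSet)) a,
      (fun i => (Fin.snoc v a : Fin (k + 2) → ↥(X : Set ZFSet))
        (Fin.lastCases (Fin.last _) (fun j => j.castSucc.castSucc) i)) =
        (Fin.snoc (fun j => v j.castSucc) a : Fin (k + 1) → _) := by
    intro v a
    funext i
    refine Fin.lastCases ?_ (fun j => ?_) i <;> simp
  simp only [Op, pmem_memV, hA, isTriple_memV, mem_tup_image_succ, Set.mem_ofPred_eq, e,
    ZFSet.pair_inj, memV]
  constructor
  · rintro ⟨s, x, y, ⟨v, a, h, rfl, rfl⟩, hx, rfl⟩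
    refine ⟨Fin.snoc v ⟨x, hx⟩, a, by simpa using h, ?_⟩
    rw [tup_snoc]
  · rintro ⟨v, a, h, rfl⟩
    exact ⟨_, _, _, ⟨_, a, h, rfl, rfl⟩, (v (Fin.last k)).2, by rw [tup_succ v]; rfl⟩

theorem op_six (a b z : ZFSet) : Op memV 6 a b z ↔ ∃ s x y, s ∈ a ∧ x ∈ b ∧ y ∈ b ∧
    z = ZFSet.pair (ZFSet.pair s x) y ∧ x ∈ y := by simp [Op]

theorem op_seven (a b z : ZFSet) : Op memV 7 a b z ↔ ∃ s x y, s ∈ a ∧ x ∈ b ∧ y ∈ b ∧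
    z = ZFSet.pair (ZFSet.pair s x) y ∧ y ∈ x := by simp [Op]

theorem op_eight (a b z : ZFSet) : Op memV 8 a b z ↔ ∃ s x y, s ∈ a ∧ x ∈ b ∧ y ∈ b ∧
    z = ZFSet.pair (ZFSet.pair s x) y ∧ x = y := by simp only [Op, memV, isTriple_memV]

end Ops

/-- `Q` is closed under the operations generating the definable relations over `X`. -/
structure OpClosed (X : ZFSet.{0}) (Q : ZFSet.{0} → Prop) : Prop where
  base : Q {∅}
  op : ∀ {i : Fin 10} {B}, 4 ≤ i → Q B → ∃ A, Q A ∧ ∀ z, z ∈ A ↔ Op memV i B X z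
  diff : ∀ {B B'}, Q B → Q B' → ∃ A, Q A ∧ ∀ z, z ∈ A ↔ Op memV 3 B B' z

/-- Some set satisfying `Q` codes the relation `S`. -/
def Coded {X : ZFSet.{0}} (Q : ZFSet.{0} → Prop) {k : ℕ}
    (S : Set (Fin k → ↥(X : Set ZFSet))) : Prop :=
  ∃ A, Q A ∧ ∀ z, z ∈ A ↔ z ∈ tup '' S

namespace OpClosed

variable {X : ZFSet.{0}} {Q : ZFSet.{0} → Prop} {k : ℕ}

theorem coded_op (h : OpClosed X Q) {i : Fin 10} (hi : 4 ≤ i) {l : ℕ}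
    {S : Set (Fin k → ↥(X : Set ZFSet))} {S' : Set (Fin l → ↥(X : Set ZFSet))} (hS : Coded Q S)
    (hop : ∀ A, (∀ z, z ∈ A ↔ z ∈ tup '' S) → ∀ z, Op memV i A X z ↔ z ∈ tup '' S') :
    Coded Q S' := by
  obtain ⟨B, hB, hBS⟩ := hS
  obtain ⟨A, hA, hAB⟩ := h.op hi hB
  exact ⟨A, hA, fun z => (hAB z).trans (hop B hBS z)⟩

theorem coded_diff (h : OpClosed X Q) {S S' : Set (Fin k → ↥(X : Set ZFSet))} (hS : Coded Q S)
    (hS' : Coded Q S') : Coded Q (S \ S') := by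
  obtain ⟨B, hB, hBS⟩ := hS
  obtain ⟨B', hB', hBS'⟩ := hS'
  obtain ⟨A, hA, hAB⟩ := h.diff hB hB'
  exact ⟨A, hA, fun z => (hAB z).trans (op_diff hBS hBS' z)⟩

theorem coded_prod (h : OpClosed X Q) {S : Set (Fin k → ↥(X : Set ZFSet))} (hS : Coded Q S) :
    Coded Q {v : Fin (k + 1) → ↥(X : Set ZFSet) | (fun i => v i.castSucc) ∈ S} :=
  h.coded_op (i := 4) (by decide) hS fun _ hA => op_prod hA

theorem coded_univ (h : OpClosed X Q) : ∀ k : ℕ,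
    Coded Q (Set.univ : Set (Fin k → ↥(X : Set ZFSet)))
  | 0 => ⟨{∅}, h.base, fun z => by
      simp only [ZFSet.mem_singleton, Set.image_univ, Set.mem_range, tup_zero]
      exact ⟨fun h => ⟨default, h.symm⟩, fun ⟨_, h⟩ => h.symm⟩⟩
  | k + 1 => h.coded_prod (h.coded_univ k)

theorem coded_compl (h : OpClosed X Q) {S : Set (Fin k → ↥(X : Set ZFSet))} (hS : Coded Q S) :
    Coded Q Sᶜ := by
  rw [Set.compl_eq_univ_sdiff]
  exact h.coded_diff (h.coded_univ k) hS

theorem coded_empty (h : OpClosed X Q) : Coded Q (∅ : Set (Fin k → ↥(X : Set ZFSet))) := by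
  rw [← Set.compl_univ]
  exact h.coded_compl (h.coded_univ k)

/-- Relations between an arbitrary coordinate and the last one. -/
theorem coded_rel_last (h : OpClosed X Q) {i : Fin 10} (hi4 : 4 ≤ i) {R : ZFSet → ZFSet → Prop}
    (hi : ∀ a b z, Op memV i a b z ↔ ∃ s x y, s ∈ a ∧ x ∈ b ∧ y ∈ b ∧
      z = ZFSet.pair (ZFSet.pair s x) y ∧ R x y) : ∀ {k : ℕ} (j : Fin k),
    Coded Q {v : Fin (k + 1) → ↥(X : Set ZFSet) | R (v j.castSucc) (v (Fin.last k))}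
  | 0, j => j.elim0
  | k + 1, j => by
    refine Fin.lastCases ?_ (fun j => ?_) j
    · refine h.coded_op hi4 (h.coded_univ k) fun A hA z => ?_
      rw [op_rel hi hA]
      simp
    · refine h.coded_op (i := 9) (by decide) (h.coded_rel_last hi4 hi j) fun A hA z => ?_
      rw [op_insert hA]
      simp

theorem coded_rel (h : OpClosed X Q) {R : ZFSet → ZFSet → Prop} {i i' : Fin 10} (hi4 : 4 ≤ i)
    (hi4' : 4 ≤ i')
    (hi : ∀ a b z, Op memV i a b z ↔ ∃ s x y, s ∈ a ∧ x ∈ b ∧ y ∈ b ∧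
      z = ZFSet.pair (ZFSet.pair s x) y ∧ R x y)
    (hi' : ∀ a b z, Op memV i' a b z ↔ ∃ s x y, s ∈ a ∧ x ∈ b ∧ y ∈ b ∧
      z = ZFSet.pair (ZFSet.pair s x) y ∧ R y x) : ∀ {k : ℕ} (j l : Fin k), j ≠ l →
    Coded Q {v : Fin k → ↥(X : Set ZFSet) | R (v j) (v l)}
  | 0, j, _, _ => j.elim0
  | k + 1, j, l, hjl => by
    induction j using Fin.lastCases with
    | last =>
      induction l using Fin.lastCases with
      | last => exact absurd rfl hjl
      | cast l => exact h.coded_rel_last hi4' (R := fun x y => R y x) hi' l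
    | cast j =>
      induction l using Fin.lastCases with
      | last => exact h.coded_rel_last hi4 hi j
      | cast l => exact h.coded_prod (coded_rel h hi4 hi4' hi hi' j l fun e => hjl (by rw [e]))

theorem coded_mem (h : OpClosed X Q) (j l : Fin k) :
    Coded Q {v : Fin k → ↥(X : Set ZFSet) | (v j : ZFSet) ∈ (v l : ZFSet)} := by
  by_cases hjl : j = l
  · subst hjl
    simpa [ZFSet.mem_irrefl] using h.coded_empty
  · exact h.coded_rel (R := fun x y => x ∈ y) (i := 6) (i' := 7) (by decide) (by decide) op_six
      op_seven j l hjl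

theorem coded_eq (h : OpClosed X Q) (j l : Fin k) :
    Coded Q {v : Fin k → ↥(X : Set ZFSet) | v j = v l} := by
  by_cases hjl : j = l
  · subst hjl
    simpa using h.coded_univ k
  · simp only [Subtype.ext_iff]
    refine h.coded_rel (R := fun x y => x = y) (i := 8) (i' := 8) (by decide) (by decide) op_eight
      (fun a b z => ?_) j l hjl
    simp only [op_eight, eq_comm]

theorem coded_formula (h : OpClosed X Q) {k : ℕ} (φ : memLang.BoundedFormula Empty k) :
    Coded Q {v : Fin k → ↥(X : Set ZFSet) |
      let _ := memStruc (X : Set ZFSet); φ.Realize default v} := by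
  let _ := memStruc (X : Set ZFSet)
  have hterm : ∀ {k : ℕ} (t : memLang.Term (Empty ⊕ Fin k)), ∃ j : Fin k,
      ∀ v : Fin k → ↥(X : Set ZFSet), t.realize (Sum.elim default v) = v j := by
    intro k t
    cases t with
    | var i =>
      cases i with
      | inl i => exact i.elim
      | inr j => exact ⟨j, fun v => rfl⟩
    | func f _ => exact Empty.elim f
  induction φ with
  | falsum => simpa [Language.BoundedFormula.Realize] using h.coded_empty
  | equal t₁ t₂ =>
    obtain ⟨j, hj⟩ := hterm t₁
    obtain ⟨l, hl⟩ := hterm t₂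
    simpa [Language.BoundedFormula.Realize, hj, hl] using h.coded_eq j l
  | @rel n m R ts =>
    obtain ⟨rfl⟩ := R
    obtain ⟨j, hj⟩ := hterm (ts 0)
    obtain ⟨l, hl⟩ := hterm (ts 1)
    have := h.coded_mem j l
    simp only [← hj, ← hl] at this
    exact this
  | imp φ ψ h1 h2 =>
    have := h.coded_compl (h.coded_diff h1 h2)
    convert this using 1
    ext v
    simp [Language.BoundedFormula.realize_imp]
  | all φ ih =>
    have := h.coded_compl (h.coded_op (i := 5) (by decide) (h.coded_compl ih)
      fun _ hA => op_dom hA)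
    convert this using 1
    ext v
    simp [Language.BoundedFormula.realize_all]

end OpClosed

/-- The relation `S` is defined over `X` by a formula without parameters. -/
def PureDef {X : ZFSet.{0}} {k : ℕ} (S : Set (Fin k → ↥(X : Set ZFSet))) : Prop :=
  ∃ P, UDef (ι := Fin k) P ∧ ∀ v, v ∈ S ↔ P _ (memOn (X : Set ZFSet)) v

theorem OpClosed.coded {X : ZFSet.{0}} {Q : ZFSet.{0} → Prop} {k : ℕ} (h : OpClosed X Q)
    {S : Set (Fin k → ↥(X : Set ZFSet))} (hS : PureDef S) : Coded Q S := by
  obtain ⟨P, ⟨φ, hφ⟩, hP⟩ := hS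
  convert h.coded_formula (k := k) (Language.BoundedFormula.relabel
    (n := k) (k := 0) (Sum.inr : Fin k → Empty ⊕ Fin k) φ) using 1
  ext v
  rw [hP, ← hφ]
  let _ := memStruc (X : Set ZFSet)
  exact (Language.Formula.realize_relabel_sumInr φ).symm

theorem fodef_iff {X z : ZFSet.{0}} : FODef (X : Set ZFSet) (z : Set ZFSet) ↔
    ∃ (n : ℕ) (S : Set (Fin (n + 1) → ↥(X : Set ZFSet))) (a : Fin n → ↥(X : Set ZFSet)),
      PureDef S ∧ ∀ b, b ∈ z ↔ ∃ hb : b ∈ X, (Fin.snoc a ⟨b, hb⟩ : Fin (n + 1) → _) ∈ S := by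
  constructor
  · rintro ⟨-, n, φ, a, h⟩
    let _ := memStruc (X : Set ZFSet)
    refine ⟨n, {v | φ.Realize v}, a, ⟨_, ⟨φ, fun _ _ _ => Iff.rfl⟩, fun v => Iff.rfl⟩, fun b => ?_⟩
    rw [← SetLike.mem_coe, h]
    rfl
  · rintro ⟨n, S, a, ⟨P, ⟨φ, hφ⟩, hP⟩, h⟩
    refine ⟨fun b hb => ((h b).1 hb).1, n, φ, a, ?_⟩
    ext b
    rw [SetLike.mem_coe, h]
    refine exists_congr fun hb => ?_
    rw [hP]
    exact (hφ _ _ _).symm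

/-! ### The tower of fields of the canonical orders -/

/-- The union of the countable stages `xset α`. -/
def WOmega1 : Set ZFSet.{0} := {x | ∃ α < Ordinal.omega 1, x ∈ xset α}

theorem xset_mem_WOmega1 {α : Ordinal.{0}} (hα : α < Ordinal.omega 1) : xset α ∈ WOmega1 :=
  ⟨α + 1, add_one_lt_omega_one hα, xset_mem_xset.2 (lt_add_one α)⟩

theorem exists_isSuccLimit_lt_omega_one {α : Ordinal.{0}} (hα : α < Ordinal.omega 1) :
    ∃ β < Ordinal.omega 1, α ≤ β ∧ Order.IsSuccLimit β := by
  refine ⟨α + Ordinal.omega0, ?_, le_self_add, Ordinal.isSuccLimit_add _ Ordinal.isSuccLimit_omega0⟩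
  rw [← Cardinal.ord_aleph] at hα ⊢
  refine Ordinal.isPrincipal_add_ord (Cardinal.aleph0_le_aleph 1) hα ?_
  rw [← Cardinal.ord_aleph0, Cardinal.ord_lt_ord]
  exact Cardinal.aleph0_lt_aleph_one

theorem transPair_WOmega1 : TransPair WOmega1 := by
  refine ⟨fun ⟨α, hα, hx⟩ hz => ⟨α, hα, xset_trans hx hz⟩, ?_⟩
  rintro x y ⟨α, hα, hx⟩ ⟨β, hβ, hy⟩
  obtain ⟨γ, hγ, hle, hlim⟩ := exists_isSuccLimit_lt_omega_one (max_lt hα hβ)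
  exact ⟨γ, hγ, (transPair_xset hlim).upair (xset_mono ((le_max_left _ _).trans hle) hx)
    (xset_mono ((le_max_right _ _).trans hle) hy)⟩

theorem empty_mem_WOmega1 : ∅ ∈ WOmega1 := ⟨0, isSuccLimit_omega_one.bot_lt, empty_mem_xset 0⟩

theorem op_mem_WOmega1 {i : Fin 10} (hi : i ≠ 0) {a b : ZFSet} (ha : a ∈ WOmega1)
    (hb : b ∈ WOmega1) : ∃ y ∈ WOmega1, ∀ z, z ∈ y ↔ Op memV i a b z := by
  obtain ⟨α, hα, ha⟩ := ha
  obtain ⟨β, hβ, hb⟩ := hb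
  obtain ⟨γ, hγ, hle, hlim⟩ := exists_isSuccLimit_lt_omega_one (max_lt hα hβ)
  have ha := xset_mono ((le_max_left _ _).trans hle) ha
  have hb := xset_mono ((le_max_right _ _).trans hle) hb
  refine ⟨(xset γ).sep (Op memV i a b), ⟨γ + 1, add_one_lt_omega_one hγ,
    mem_xset_add_one (i := i) ha hb fun z => ZFSet.mem_sep⟩, fun z => ?_⟩
  rw [ZFSet.mem_sep]
  exact ⟨fun h => h.2, fun h => ⟨(transPair_xset hlim).op_mem hi ha hb h, h⟩⟩

theorem opClosed_WOmega1 {X : ZFSet} (hX : X ∈ WOmega1) : OpClosed X (· ∈ WOmega1) where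
  base := transPair_WOmega1.single empty_mem_WOmega1
  op := fun {i B} hi hB => op_mem_WOmega1 (by rintro rfl; exact absurd hi (by decide)) hB hX
  diff := fun hB hB' => op_mem_WOmega1 (by decide) hB hB'

theorem TransPair.tup_mem {K : Set ZFSet.{0}} (hK : TransPair K) (h0 : ∅ ∈ K) {X : ZFSet}
    (hX : X ∈ K) : ∀ {n : ℕ} (a : Fin n → ↥(X : Set ZFSet)), tup a ∈ K
  | 0, _ => h0
  | _ + 1, a => hK.pair (hK.tup_mem h0 hX _) (hK.trans hX (a _).2)

theorem mem_section_iff {X A : ZFSet.{0}} {n : ℕ} {S : Set (Fin (n + 1) → ↥(X : Set ZFSet))}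
    (hA : ∀ z, z ∈ A ↔ z ∈ tup '' S) (a : Fin n → ↥(X : Set ZFSet)) (b : ZFSet) :
    ZFSet.pair (tup a) b ∈ A ↔ ∃ hb : b ∈ X, (Fin.snoc a ⟨b, hb⟩ : Fin (n + 1) → _) ∈ S := by
  rw [hA, pair_mem_tup_image]
  constructor
  · rintro ⟨v, c, h, hv, rfl⟩
    rw [← tup_injective hv]
    exact ⟨c.2, h⟩
  · rintro ⟨hb, h⟩
    exact ⟨a, ⟨b, hb⟩, h, rfl, rfl⟩

theorem mem_WOmega1_of_fodef {X x : ZFSet} (hX : X ∈ WOmega1)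
    (h : FODef (X : Set ZFSet) (x : Set ZFSet)) : x ∈ WOmega1 := by
  obtain ⟨n, S, a, hS, hx⟩ := fodef_iff.1 h
  obtain ⟨A, hA, hAS⟩ := (opClosed_WOmega1 hX).coded hS
  obtain ⟨y, hy, hyA⟩ := op_mem_WOmega1 (i := 2) (by decide) hA
    (transPair_WOmega1.tup_mem empty_mem_WOmega1 hX a)
  convert hy
  ext b
  rw [hx, hyA]
  simp only [Op, pmem_memV]
  rw [mem_section_iff hAS]

theorem tower_xset : Tower xset WOmega1 where
  mem_iff := Iff.rfl
  mono := fun h hx => xset_mono h hx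
  trans := xset_trans
  countable := countable_xset
  cont := fun hα hx => exists_lt_mem_xset hα hx
  fodef := fun hα h => mem_WOmega1_of_fodef (xset_mem_WOmega1 hα) h

/-! ### Definability over a set, expressed inside the tower -/

namespace PureDef

variable {X : ZFSet.{0}} {k : ℕ}

theorem reindex {S : Set (Fin k → ↥(X : Set ZFSet))} (h : PureDef S) {l : ℕ} (g : Fin k → Fin l) :
    PureDef {v : Fin l → ↥(X : Set ZFSet) | (fun i => v (g i)) ∈ S} := by
  obtain ⟨P, hP, h⟩ := h
  exact ⟨_, hP.reindex g, fun v => h _⟩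

theorem inter {S S' : Set (Fin k → ↥(X : Set ZFSet))} (h : PureDef S) (h' : PureDef S') :
    PureDef (S ∩ S') := by
  obtain ⟨P, hP, h⟩ := h
  obtain ⟨P', hP', h'⟩ := h'
  exact ⟨_, hP.and hP', fun v => and_congr (h v) (h' v)⟩

theorem diff {S S' : Set (Fin k → ↥(X : Set ZFSet))} (h : PureDef S) (h' : PureDef S') :
    PureDef (S \ S') := by
  obtain ⟨P, hP, h⟩ := h
  obtain ⟨P', hP', h'⟩ := h'
  exact ⟨_, hP.and hP'.not, fun v => and_congr (h v) (not_congr (h' v))⟩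

theorem ex {S : Set (Fin (k + 1) → ↥(X : Set ZFSet))} (h : PureDef S) :
    PureDef {v : Fin k → ↥(X : Set ZFSet) | ∃ a, (Fin.snoc v a : Fin (k + 1) → _) ∈ S} := by
  obtain ⟨P, hP, h⟩ := h
  have := hP.reindex (κ := Option (Fin k)) (Fin.lastCases none some)
  refine ⟨_, UDef.ex (P := fun A E v a => P A E (Fin.snoc v a)) (this.congr fun A E w => ?_),
    fun v => exists_congr fun a => h _⟩
  have e : (fun i => w (Fin.lastCases none some i)) =
      (Fin.snoc (fun i => w (some i)) (w none) : Fin (k + 1) → A) := by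
    funext i
    refine Fin.lastCases ?_ (fun j => ?_) i <;> simp
  rw [e]

theorem univ : PureDef (Set.univ : Set (Fin k → ↥(X : Set ZFSet))) :=
  ⟨_, UDef.const True, fun _ => Iff.rfl⟩

theorem empty : PureDef (∅ : Set (Fin k → ↥(X : Set ZFSet))) :=
  ⟨_, UDef.const False, fun _ => Iff.rfl⟩

end PureDef

theorem exists_pureDef_op {X B D : ZFSet.{0}} {i : Fin 10} (hi : 4 ≤ i) {k : ℕ}
    {S : Set (Fin k → ↥(X : Set ZFSet))} (hS : PureDef S) (hB : ∀ z, z ∈ B ↔ z ∈ tup '' S)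
    (hD : ∀ z, z ∈ D ↔ Op memV i B X z) :
    ∃ (l : ℕ) (S' : Set (Fin l → ↥(X : Set ZFSet))), PureDef S' ∧ ∀ z, z ∈ D ↔ z ∈ tup '' S' := by
  have hemp : (∀ z, ¬ Op memV i B X z) → ∃ (l : ℕ) (S' : Set (Fin l → ↥(X : Set ZFSet))),
      PureDef S' ∧ ∀ z, z ∈ D ↔ z ∈ tup '' S' := fun h =>
    ⟨0, ∅, PureDef.empty, fun z => by simp [hD, h]⟩
  have hrel : ∀ {R : ZFSet → ZFSet → Prop}, (∀ a b z, Op memV i a b z ↔ ∃ s x y, s ∈ a ∧ x ∈ b ∧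
      y ∈ b ∧ z = ZFSet.pair (ZFSet.pair s x) y ∧ R x y) →
      PureDef {v : Fin (k + 2) → ↥(X : Set ZFSet) |
        R (v (Fin.last k).castSucc) (v (Fin.last (k + 1)))} →
      ∃ (l : ℕ) (S' : Set (Fin l → ↥(X : Set ZFSet))), PureDef S' ∧ ∀ z, z ∈ D ↔ z ∈ tup '' S' :=
    fun hop hR => ⟨_, _, (hS.reindex fun i => i.castSucc.castSucc).inter hR,
      fun z => (hD z).trans (op_rel hop hB z)⟩
  obtain rfl | rfl | rfl | rfl | rfl | rfl : i = 4 ∨ i = 5 ∨ i = 6 ∨ i = 7 ∨ i = 8 ∨ i = 9 :=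
    (by decide : ∀ i : Fin 10, 4 ≤ i → i = 4 ∨ i = 5 ∨ i = 6 ∨ i = 7 ∨ i = 8 ∨ i = 9) i hi
  · exact ⟨_, _, hS.reindex Fin.castSucc, fun z => (hD z).trans (op_prod hB z)⟩
  · cases k with
    | zero => exact hemp (op_dom_zero hB)
    | succ k => exact ⟨_, _, hS.ex, fun z => (hD z).trans (op_dom hB z)⟩
  · exact hrel op_six ⟨_, UDef.mem _ _, fun v => Iff.rfl⟩
  · exact hrel op_seven ⟨_, UDef.mem _ _, fun v => Iff.rfl⟩
  · exact hrel op_eight ⟨_, UDef.eq _ _, fun v => Subtype.ext_iff.symm⟩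
  · cases k with
    | zero => exact hemp (op_insert_zero hB)
    | succ k => exact ⟨_, _, hS.reindex _, fun z => (hD z).trans (op_insert hB z)⟩

theorem Deriv.exists_pureDef {X C : ZFSet.{0}} (hC : Deriv memV X C) (k D : ZFSet)
    (h : ZFSet.pair k D ∈ C) :
    ∃ (n : ℕ) (S : Set (Fin n → ↥(X : Set ZFSet))), PureDef S ∧ ∀ z, z ∈ D ↔ z ∈ tup '' S := by
  induction k using ZFSet.inductionOn generalizing D with
  | h k ih =>
    rcases hC k D (pmem_memV.2 h) with hD | ⟨k', B, hk, hB, i, hi, hD⟩ |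
      ⟨k', B, l', B', hk, hB, hl, hB', hD⟩
    · refine ⟨0, Set.univ, PureDef.univ, fun z => (hD z).trans ?_⟩
      simp only [Set.image_univ, Set.mem_range, tup_zero, memV, ← ZFSet.eq_empty]
      exact ⟨fun h => ⟨default, h.symm⟩, fun ⟨_, h⟩ => h.symm⟩
    · obtain ⟨n, S, hS, hBS⟩ := ih k' hk B (pmem_memV.1 hB)
      exact exists_pureDef_op hi hS hBS hD
    · obtain ⟨n, S, hS, hBS⟩ := ih k' hk B (pmem_memV.1 hB)
      obtain ⟨m, S', hS', hBS'⟩ := ih l' hl B' (pmem_memV.1 hB')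
      by_cases hnm : n = m
      · subst hnm
        exact ⟨n, _, hS.diff hS', fun z => (hD z).trans (op_diff hBS hBS' z)⟩
      · exact ⟨n, S, hS, fun z => (hD z).trans (op_diff_of_ne hnm hBS hBS' z)⟩

theorem fodef_empty (X : ZFSet.{0}) {z : ZFSet} (hz : ∀ x, x ∉ z) :
    FODef (X : Set ZFSet) (z : Set ZFSet) :=
  fodef_iff.2 ⟨0, ∅, default, PureDef.empty, fun b => by simp [hz b]⟩

theorem fodef_of_section {X D p z : ZFSet.{0}} {n : ℕ} {S : Set (Fin n → ↥(X : Set ZFSet))}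
    (hS : PureDef S) (hD : ∀ z, z ∈ D ↔ z ∈ tup '' S) (hz : ∀ x, x ∈ z ↔ ZFSet.pair p x ∈ D) :
    FODef (X : Set ZFSet) (z : Set ZFSet) := by
  cases n with
  | zero => exact fodef_empty X fun x hx => pair_notMem_tup_image_zero ((hD _).1 ((hz x).1 hx))
  | succ n =>
    by_cases hp : ∃ a : Fin n → ↥(X : Set ZFSet), tup a = p
    · obtain ⟨a, rfl⟩ := hp
      exact fodef_iff.2 ⟨n, S, a, hS, fun b => (hz b).trans (mem_section_iff hD a b)⟩
    · refine fodef_empty X fun x hx => ?_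
      obtain ⟨v, a, -, hv, -⟩ := pair_mem_tup_image.1 ((hD _).1 ((hz x).1 hx))
      exact hp ⟨v, hv⟩

namespace Tower

variable {S : Ordinal.{0} → ZFSet.{0}} {K : Set ZFSet.{0}}

theorem union_mem (h : Tower S K) {x y : ZFSet} (hx : x ∈ K) (hy : y ∈ K) : x ∪ y ∈ K := by
  have hc : {b : ↥K | memOn K b ⟨x, hx⟩ ∨ memOn K b ⟨y, hy⟩}.Countable :=
    (((h.countable_of_mem hx).union (h.countable_of_mem hy)).preimage
      Subtype.val_injective).mono fun b hb => hb
  obtain ⟨p, hp, hmem⟩ := h.mem_of_udef (P := fun A E a z => E z (a 0) ∨ E z (a 1))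
    ((UDef.mem _ _).or (UDef.mem _ _)) ![⟨x, hx⟩, ⟨y, hy⟩] hc
  convert hp
  ext z
  rw [hmem, ZFSet.mem_union]
  exact ⟨fun hz => ⟨hz.elim (h.transPair.trans hx) (h.transPair.trans hy), hz⟩, fun hz => hz.2⟩

end Tower

/-- `D` occurs in a derivation over `X` that belongs to `K`. -/
def DerivableIn (K : Set ZFSet.{0}) (X D : ZFSet.{0}) : Prop :=
  ∃ C ∈ K, ∃ k, Deriv memV X C ∧ ZFSet.pair k D ∈ C

theorem Deriv.union {X C C' k D : ZFSet.{0}} (hC : Deriv memV X C) (hC' : Deriv memV X C')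
    (hD : (∃ k' B, k' ∈ k ∧ ZFSet.pair k' B ∈ C ∧ ∃ i : Fin 10, 4 ≤ i ∧
        ∀ z, z ∈ D ↔ Op memV i B X z) ∨
      (∃ k' B l' B', k' ∈ k ∧ ZFSet.pair k' B ∈ C ∧ l' ∈ k ∧ ZFSet.pair l' B' ∈ C' ∧
        ∀ z, z ∈ D ↔ Op memV 3 B B' z)) :
    Deriv memV X (C ∪ C' ∪ {ZFSet.pair k D}) := by
  have mono : ∀ {C₁ k₁ D₁}, Deriv memV X C₁ → (∀ z ∈ C₁, z ∈ C ∪ C' ∪ {ZFSet.pair k D}) →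
      ZFSet.pair k₁ D₁ ∈ C₁ → _ := fun {C₁ k₁ D₁} h₁ hs hp =>
    (h₁ k₁ D₁ (pmem_memV.2 hp)).imp_right fun h => h.imp
      (fun ⟨k', B, hk, hB, h⟩ => (⟨k', B, hk, pmem_memV.2 (hs _ (pmem_memV.1 hB)), h⟩ :
        ∃ k' B, memV k' k₁ ∧ PMem memV k' B (C ∪ C' ∪ {ZFSet.pair k D}) ∧ ∃ i : Fin 10, 4 ≤ i ∧
          ∀ z, memV z D₁ ↔ Op memV i B X z))
      (fun ⟨k', B, l', B', hk, hB, hl, hB', h⟩ =>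
        (⟨k', B, l', B', hk, pmem_memV.2 (hs _ (pmem_memV.1 hB)), hl,
          pmem_memV.2 (hs _ (pmem_memV.1 hB')), h⟩ :
        ∃ k' B l' B', memV k' k₁ ∧ PMem memV k' B (C ∪ C' ∪ {ZFSet.pair k D}) ∧ memV l' k₁ ∧
          PMem memV l' B' (C ∪ C' ∪ {ZFSet.pair k D}) ∧ ∀ z, memV z D₁ ↔ Op memV 3 B B' z))
  intro k₁ D₁ hp
  have hp' := pmem_memV.1 hp
  simp only [ZFSet.mem_union, ZFSet.mem_singleton, ZFSet.pair_inj] at hp'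
  rcases hp' with (hp' | hp') | ⟨rfl, rfl⟩
  · exact mono hC (fun z hz => by simp [hz]) hp'
  · exact mono hC' (fun z hz => by simp [hz]) hp'
  · refine Or.inr (hD.imp ?_ ?_)
    · rintro ⟨k', B, hk, hB, h⟩
      exact ⟨k', B, hk, pmem_memV.2 (by simp [hB]), h⟩
    · rintro ⟨k', B, l', B', hk, hB, hl, hB', h⟩
      exact ⟨k', B, l', B', hk, pmem_memV.2 (by simp [hB]), hl, pmem_memV.2 (by simp [hB']), h⟩

theorem opClosed_derivableIn {X : ZFSet} (hX : X ∈ WOmega1) :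
    OpClosed X (DerivableIn WOmega1 X) := by
  have hW := transPair_WOmega1
  have hmem : ∀ {C k D : ZFSet}, C ∈ WOmega1 → ZFSet.pair k D ∈ C → k ∈ WOmega1 ∧ D ∈ WOmega1 :=
    fun hC h => hW.of_pair_mem hC h
  refine ⟨?_, ?_, ?_⟩
  · refine ⟨{ZFSet.pair ∅ {∅}}, hW.single (hW.pair empty_mem_WOmega1
      (hW.single empty_mem_WOmega1)), ∅, fun k D hp => ?_, by simp⟩
    rw [pmem_memV, ZFSet.mem_singleton, ZFSet.pair_inj] at hp
    refine Or.inl fun z => ?_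
    simp [hp.2, memV, ← ZFSet.eq_empty]
  · rintro i B hi ⟨C, hCW, k, hC, hB⟩
    obtain ⟨A, hA, hAB⟩ := (opClosed_WOmega1 hX).op hi (hmem hCW hB).2
    refine ⟨A, ⟨C ∪ C ∪ {ZFSet.pair {k} A}, ?_, {k}, hC.union hC
      (Or.inl ⟨k, B, by simp, hB, i, hi, hAB⟩), by simp⟩, hAB⟩
    exact tower_xset.union_mem (tower_xset.union_mem hCW hCW)
      (hW.single (hW.pair (hW.single (hmem hCW hB).1) hA))
  · rintro B B' ⟨C, hCW, k, hC, hB⟩ ⟨C', hCW', k', hC', hB'⟩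
    obtain ⟨A, hA, hAB⟩ := (opClosed_WOmega1 hX).diff (hmem hCW hB).2 (hmem hCW' hB').2
    refine ⟨A, ⟨C ∪ C' ∪ {ZFSet.pair {k, k'} A}, ?_, {k, k'}, hC.union hC'
      (Or.inr ⟨k, B, k', B', by simp, hB, by simp, hB', hAB⟩), by simp⟩, hAB⟩
    exact tower_xset.union_mem (tower_xset.union_mem hCW hCW')
      (hW.single (hW.pair (hW.upair (hmem hCW hB).1 (hmem hCW' hB').1) hA))

theorem defNext_WOmega1 (X z : ↥WOmega1) :
    DefNext (memOn WOmega1) X z ↔ FODef ((X : ZFSet) : Set ZFSet) ((z : ZFSet) : Set ZFSet) := by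
  have hW := transPair_WOmega1
  constructor
  · rintro ⟨D, p, ⟨C, k, hC, hD⟩, hz⟩
    rw [hW.deriv empty_mem_WOmega1] at hC
    obtain ⟨n, S, hS, hDS⟩ := hC.exists_pureDef k D (hW.pmem.1 hD)
    refine fodef_of_section hS hDS (p := p) ?_
    simp only [hW.pmem] at hz
    exact (hW.ext_iff z.2 (p := fun x => ZFSet.pair p x ∈ (D : ZFSet))
      fun x hx => (hW.of_pair_mem D.2 hx).2).1 hz
  · intro h
    obtain ⟨n, S, a, hS, hx⟩ := fodef_iff.1 h
    obtain ⟨D, ⟨C, hCW, k, hC, hD⟩, hDS⟩ := (opClosed_derivableIn X.2).coded hS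
    have hkD := hW.of_pair_mem hCW hD
    refine ⟨⟨D, hkD.2⟩, ⟨tup a, hW.tup_mem empty_mem_WOmega1 X.2 a⟩,
      ⟨⟨C, hCW⟩, ⟨k, hkD.1⟩, (hW.deriv empty_mem_WOmega1 _ _).2 hC, hW.pmem.2 hD⟩, fun x => ?_⟩
    rw [hW.pmem, mem_section_iff hDS]
    exact hx x

/-! ### Hierarchies and their stages as seen by a class -/

/-- On the class `K`, the relativized start `B`, steps `N` and precedence `G` agree with `B'`,
`N'` and `G'`, and `H` is the hierarchy iterating `N'` from `B'`. -/
structure StageSpec (B : ∀ (A : Type 1), (A → A → Prop) → A → Prop)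
    (N G : ∀ (A : Type 1), (A → A → Prop) → A → A → Prop) (K : Set ZFSet.{0})
    (B' : ZFSet.{0} → Prop) (N' G' : ZFSet.{0} → ZFSet.{0} → Prop)
    (H : Ordinal.{0} → ZFSet.{0}) : Prop where
  trans : ∀ {x z : ZFSet}, x ∈ K → z ∈ x → z ∈ K
  base : ∀ x : ↥K, B ↥K (memOn K) x ↔ B' x
  step : ∀ Q x : ↥K, N ↥K (memOn K) Q x ↔ N' Q x
  prec : ∀ Q R : ↥K, G ↥K (memOn K) Q R ↔ G' Q R
  base_mem : ∀ {x}, B' x → x ∈ K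
  step_mem : ∀ {Q x}, Q ∈ K → N' Q x → x ∈ K
  mem_iff : ∀ {α x}, x ∈ H α ↔ B' x ∨ ∃ β < α, N' (H β) x
  infl : ∀ {α x}, x ∈ H α → N' (H α) x
  wf : WellFounded G'

namespace StageSpec

variable {B : ∀ (A : Type 1), (A → A → Prop) → A → Prop}
  {N G : ∀ (A : Type 1), (A → A → Prop) → A → A → Prop} {K : Set ZFSet.{0}}
  {B' : ZFSet.{0} → Prop} {N' G' : ZFSet.{0} → ZFSet.{0} → Prop} {H : Ordinal.{0} → ZFSet.{0}}

theorem hist_iff (h : StageSpec B N G K B' N' G' H) {C : ↥K} : Hist B N G (memOn K) C ↔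
    ∀ R ∈ (C : ZFSet), ∀ x, x ∈ R ↔ B' x ∨ ∃ Q ∈ (C : ZFSet), G' Q R ∧ N' Q x := by
  constructor
  · intro hC R hR x
    have hRK := h.trans C.2 hR
    constructor
    · intro hx
      refine ((hC ⟨R, hRK⟩ hR ⟨x, h.trans hRK hx⟩).1 hx).imp (h.base _).1 ?_
      rintro ⟨Q, hQ, hG, hN⟩
      exact ⟨Q, hQ, (h.prec _ _).1 hG, (h.step _ _).1 hN⟩
    · rintro (hx | ⟨Q, hQ, hG, hN⟩)
      · exact (hC ⟨R, hRK⟩ hR ⟨x, h.base_mem hx⟩).2 (Or.inl ((h.base _).2 hx))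
      · have hQK := h.trans C.2 hQ
        exact (hC ⟨R, hRK⟩ hR ⟨x, h.step_mem hQK hN⟩).2
          (Or.inr ⟨⟨Q, hQK⟩, hQ, (h.prec _ _).2 hG, (h.step _ _).2 hN⟩)
  · intro hC R hR x
    refine (hC R hR x).trans (or_congr (h.base x).symm ?_)
    constructor
    · rintro ⟨Q, hQ, hG, hN⟩
      exact ⟨⟨Q, h.trans C.2 hQ⟩, hQ, (h.prec _ _).2 hG, (h.step _ _).2 hN⟩
    · rintro ⟨Q, hQ, hG, hN⟩
      exact ⟨Q, hQ, (h.prec _ _).1 hG, (h.step _ _).1 hN⟩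

theorem mono (h : StageSpec B N G K B' N' G' H) {α β : Ordinal.{0}} {x : ZFSet} (hαβ : α ≤ β)
    (hx : x ∈ H α) : x ∈ H β :=
  h.mem_iff.2 ((h.mem_iff.1 hx).imp_right fun ⟨γ, hγ, hx⟩ => ⟨γ, hγ.trans_le hαβ, hx⟩)

theorem step_mono (h : StageSpec B N G K B' N' G' H) {α β : Ordinal.{0}} {x : ZFSet} (hαβ : α ≤ β)
    (hx : N' (H α) x) : N' (H β) x := by
  rcases hαβ.eq_or_lt with rfl | hlt
  · exact hx
  · exact h.infl (h.mem_iff.2 (Or.inr ⟨α, hlt, hx⟩))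

theorem exists_eq_of_mem (h : StageSpec B N G K B' N' G' H) {C : ZFSet}
    (hC : ∀ R ∈ C, ∀ x, x ∈ R ↔ B' x ∨ ∃ Q ∈ C, G' Q R ∧ N' Q x) (R : ZFSet) (hR : R ∈ C) :
    ∃ α, R = H α := by
  induction R using h.wf.induction with
  | _ R ih =>
    choose! b hb using ih
    let U : Set Ordinal.{0} := {α | ∀ Q ∈ C, G' Q R → b Q < α}
    have hU : U.Nonempty := by
      have : Small.{0} ↥(C : Set ZFSet) := inferInstanceAs (Small.{0} ↥C)
      have hbd : BddAbove (b '' (C : Set ZFSet)) := Ordinal.bddAbove_of_small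
      obtain ⟨δ, hδ⟩ := hbd
      exact ⟨δ + 1, fun Q hQ _ => (hδ ⟨Q, hQ, rfl⟩).trans_lt (lt_add_one δ)⟩
    refine ⟨sInf U, ?_⟩
    ext x
    rw [hC R hR, h.mem_iff]
    refine or_congr Iff.rfl ⟨?_, ?_⟩
    · rintro ⟨Q, hQ, hG, hN⟩
      refine ⟨b Q, csInf_mem hU Q hQ hG, ?_⟩
      rwa [← hb Q hG hQ]
    · rintro ⟨β, hβ, hN⟩
      have hn := notMem_of_lt_csInf hβ (OrderBot.bddBelow U)
      simp only [U, Set.mem_ofPred_eq, not_forall, not_lt] at hn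
      obtain ⟨Q, hQ, hG, hle⟩ := hn
      refine ⟨Q, hQ, hG, ?_⟩
      rw [hb Q hG hQ]
      exact h.step_mono hle hN

theorem exists_eq_of_lev (h : StageSpec B N G K B' N' G' H) {R : ↥K}
    (hR : Lev B N G (memOn K) R) : ∃ α, (R : ZFSet) = H α := by
  obtain ⟨C, hRC, hC⟩ := hR
  exact h.exists_eq_of_mem (h.hist_iff.1 hC) R hRC

section Tower

variable {S : Ordinal.{0} → ZFSet.{0}}

theorem exists_between (h : StageSpec B N G K B' N' G' H)
    (hG : ∀ {α β}, G' (H α) (H β) ↔ α < β) {α γ : Ordinal.{0}} (hαγ : α < γ)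
    (hγ : ∃ hK : H γ ∈ K, Lev B N G (memOn K) ⟨H γ, hK⟩) :
    ∃ β, α ≤ β ∧ β < γ ∧ ∃ hK : H β ∈ K, Lev B N G (memOn K) ⟨H β, hK⟩ := by
  obtain ⟨hK, C, hγC, hC⟩ := hγ
  have hC' := h.hist_iff.1 hC
  obtain ⟨x, hx, hxα⟩ : ∃ x ∈ H (α + 1), x ∉ H α := by
    by_contra! hsub
    have heq : H α = H (α + 1) := by
      ext x
      exact ⟨h.mono (lt_add_one α).le, hsub x⟩
    have hlt := hG.2 (lt_add_one α)
    rw [← heq] at hlt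
    exact lt_irrefl α (hG.1 hlt)
  have hxγ := h.mono (Order.add_one_le_of_lt hαγ) hx
  rcases (hC' _ hγC x).1 hxγ with hB | ⟨Q, hQ, hGQ, hN⟩
  · exact absurd (h.mem_iff.2 (Or.inl hB)) hxα
  · obtain ⟨β, rfl⟩ := h.exists_eq_of_mem hC' Q hQ
    refine ⟨β, ?_, hG.1 hGQ, h.trans C.2 hQ, C, hQ, hC⟩
    by_contra! hlt
    exact hxα (h.mem_iff.2 (Or.inr ⟨β, hlt, hN⟩))

theorem lev_of_lt (h : StageSpec B N G K B' N' G' H) (hS : Tower S K)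
    (hG : ∀ {α β}, G' (H α) (H β) ↔ α < β)
    (hc : ∀ {α}, α < Ordinal.omega 1 → (H α : Set ZFSet).Countable)
    (uB : ∀ {κ : Type} (x : κ), UDef fun A E v => B A E (v x))
    (uN : ∀ {κ : Type} (x y : κ), UDef fun A E v => N A E (v x) (v y))
    (uG : ∀ {κ : Type} (x y : κ), UDef fun A E v => G A E (v x) (v y))
    {α : Ordinal.{0}} (hα : α < Ordinal.omega 1) :
    ∃ hK : H α ∈ K, Lev B N G (memOn K) ⟨H α, hK⟩ := by
  induction α using WellFoundedLT.induction with
  | ind α ih =>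
    by_cases hex : ∃ γ, α ≤ γ ∧ ∃ hK : H γ ∈ K, Lev B N G (memOn K) ⟨H γ, hK⟩
    · obtain ⟨γ, ⟨hγ, hlev⟩, hmin⟩ := WellFounded.has_min (wellFounded_lt (α := Ordinal.{0}))
        {γ | α ≤ γ ∧ ∃ hK : H γ ∈ K, Lev B N G (memOn K) ⟨H γ, hK⟩} hex
      rcases hγ.eq_or_lt with rfl | hlt
      · exact hlev
      · obtain ⟨β, hβ, hβγ, hl⟩ := h.exists_between hG hlt hlev
        exact absurd hβγ (hmin β ⟨hβ, hl⟩)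
    push Not at hex
    have hlev : ∀ Q : ↥K, Lev B N G (memOn K) Q ↔ ∃ β < α, (Q : ZFSet) = H β := by
      intro Q
      constructor
      · intro hQ
        obtain ⟨β, hβ⟩ := h.exists_eq_of_lev hQ
        refine ⟨β, ?_, hβ⟩
        by_contra! hle
        exact hex β hle (hβ ▸ Q.2) (by convert hQ; exact hβ.symm)
      · rintro ⟨β, hβ, hQ⟩
        obtain ⟨_, hl⟩ := ih β hβ (hβ.trans hα)
        convert hl
    have hiff : ∀ x : ↥K, (x : ZFSet) ∈ H α ↔ B ↥K (memOn K) x ∨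
        ∃ Q, Lev B N G (memOn K) Q ∧ N ↥K (memOn K) Q x := by
      intro x
      rw [h.mem_iff, h.base]
      refine or_congr Iff.rfl ⟨?_, ?_⟩
      · rintro ⟨β, hβ, hN⟩
        obtain ⟨hK, hl⟩ := ih β hβ (hβ.trans hα)
        exact ⟨_, hl, (h.step _ _).2 hN⟩
      · rintro ⟨Q, hQ, hN⟩
        obtain ⟨β, hβ, hQ⟩ := (hlev Q).1 hQ
        exact ⟨β, hβ, hQ ▸ (h.step _ _).1 hN⟩
    have hsub : ∀ x ∈ H α, x ∈ K := by
      intro x hx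
      rcases h.mem_iff.1 hx with hx | ⟨β, hβ, hx⟩
      · exact h.base_mem hx
      · exact h.step_mem (ih β hβ (hβ.trans hα)).1 hx
    have hK : H α ∈ K := by
      obtain ⟨y, hy, hmem⟩ := hS.mem_of_udef (n := 0) (P := fun A E _ z => B A E z ∨
        ∃ Q, Lev B N G E Q ∧ N A E Q z) ((uB _).or (.ex ((UDef.lev uB uN uG _).and (uN _ _)))) ![]
        (((hc hα).preimage Subtype.val_injective).mono fun x hx => (hiff x).2 hx)
      convert hy
      ext z
      rw [hmem]
      exact ⟨fun hz => ⟨hsub z hz, (hiff ⟨z, hsub z hz⟩).1 hz⟩, fun ⟨hz, h⟩ => (hiff ⟨z, hz⟩).2 h⟩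
    have hP : ∀ Q : ↥K, Lev B N G (memOn K) Q ∨ Q = ⟨H α, hK⟩ ↔ ∃ β ≤ α, (Q : ZFSet) = H β := by
      intro Q
      rw [hlev, Subtype.ext_iff]
      simp only [le_iff_lt_or_eq, or_and_right, exists_or, exists_eq_left]
    obtain ⟨C, hCK, hmem⟩ := hS.mem_of_udef (n := 1) (P := fun A E a z => Lev B N G E z ∨ z = a 0)
      ((UDef.lev uB uN uG _).or (.eq _ _)) ![⟨H α, hK⟩] (by
        have hIic : Set.Iic α ⊆ Set.Iio (α + 1) := fun β hβ =>
          Set.mem_Iio.2 (Order.lt_add_one_iff.2 (Set.mem_Iic.1 hβ))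
        have hct := ((countable_Iio (add_one_lt_omega_one hα)).mono hIic).image H
        refine (hct.preimage Subtype.val_injective).mono fun Q hQ => ?_
        obtain ⟨β, hβ, hQ⟩ := (hP Q).1 hQ
        exact ⟨β, hβ, hQ.symm⟩)
    have hC : ∀ Q, Q ∈ C ↔ ∃ β ≤ α, Q = H β := by
      intro Q
      rw [hmem]
      constructor
      · rintro ⟨hQ, h⟩
        exact (hP ⟨Q, hQ⟩).1 h
      · rintro ⟨β, hβ, rfl⟩
        have hQ : H β ∈ K := hβ.lt_or_eq.elim (fun hβ => (ih β hβ (hβ.trans hα)).1) (· ▸ hK)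
        exact ⟨hQ, (hP ⟨_, hQ⟩).2 ⟨β, hβ, rfl⟩⟩
    refine ⟨hK, ⟨C, hCK⟩, (hC _).2 ⟨α, le_rfl, rfl⟩, h.hist_iff.2 fun R hR x => ?_⟩
    obtain ⟨β, hβ, rfl⟩ := (hC R).1 hR
    rw [h.mem_iff]
    refine or_congr Iff.rfl ⟨?_, ?_⟩
    · rintro ⟨δ, hδ, hN⟩
      exact ⟨H δ, (hC _).2 ⟨δ, hδ.le.trans hβ, rfl⟩, hG.2 hδ, hN⟩
    · rintro ⟨Q, hQ, hGQ, hN⟩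
      obtain ⟨δ, hδ, rfl⟩ := (hC Q).1 hQ
      exact ⟨δ, hG.1 hGQ, hN⟩

end Tower

end StageSpec

/-! ### The constructible hierarchy inside the tower of fields -/

theorem lset_mem_lset {α β : Ordinal.{0}} : lset β ∈ lset α ↔ β < α := by
  constructor
  · intro h
    by_contra! hle
    exact ZFSet.mem_irrefl _ (lset_mono hle h)
  · intro h
    refine mem_lset.2 ⟨β, h, ?_⟩
    have := fodef_of_udef (M := (lset β : Set ZFSet)) (n := 0) (P := fun _ _ _ _ => True)
      (UDef.const _) ![]
    simpa using this

/-- The empty start of a hierarchy. -/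
def NoBase (A : Type 1) (_ : A → A → Prop) (_ : A) : Prop := False

theorem stageSpec_lset : StageSpec NoBase (fun _ E => DefNext E) (fun _ E => E) WOmega1
    (fun _ => False) (fun X z => FODef (X : Set ZFSet) (z : Set ZFSet)) memV lset where
  trans := transPair_WOmega1.trans
  base := fun _ => Iff.rfl
  step := defNext_WOmega1
  prec := fun _ _ => Iff.rfl
  base_mem := False.elim
  step_mem := mem_WOmega1_of_fodef
  mem_iff := by simp [mem_lset]
  infl := fodef_of_mem_lset
  wf := ZFSet.mem_wf

theorem LOmega1_subset_WOmega1 : LOmega1 ⊆ WOmega1 := by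
  intro x hx
  obtain ⟨α, hα, hx⟩ := mem_LOmega1.1 hx
  obtain ⟨hK, -⟩ := stageSpec_lset.lev_of_lt tower_xset lset_mem_lset countable_lset
    (fun _ => UDef.const _) UDef.defNext UDef.mem hα
  exact transPair_WOmega1.trans hK hx

/-! ### The hierarchy of canonical orders inside a class -/

/-- `R` is a stage of the hierarchy of canonical orders. -/
abbrev OrdLev {A : Type 1} (E : A → A → Prop) (R : A) : Prop :=
  Lev (fun _ E => OrdBase E) (fun _ E => OrdNext E) (fun _ E => OrdTag E) E R

theorem wellFounded_ordTag : WellFounded (OrdTag memV) := by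
  refine Subrelation.wf (r := InvImage memV fun Q : ZFSet.{0} =>
    Q.sUnion.sUnion.sep fun x => ZFSet.pair x x ∈ Q) ?_ (InvImage.wf _ ZFSet.mem_wf)
  have hmem : ∀ Q x : ZFSet.{0}, x ∈ (Q.sUnion.sUnion.sep fun x => ZFSet.pair x x ∈ Q) ↔
      ZFSet.pair x x ∈ Q := fun Q x => by
    rw [ZFSet.mem_sep]
    exact ⟨fun h => h.2, fun h => ⟨(mem_sUnion_of_pmem h).1, h⟩⟩
  rintro Q R ⟨d, hd, hR⟩
  simp only [pmem_memV] at hd hR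
  have : d = Q.sUnion.sUnion.sep fun x => ZFSet.pair x x ∈ Q := by
    ext x
    rw [hmem]
    exact hd x
  exact (hmem R _).2 (by rwa [this] at hR)

/-- All the sets generated from the field of some `Q` exist. -/
def OpReps {A : Type 1} (E : A → A → Prop) : Prop :=
  ∀ Q a b, ∀ i : Fin 10, PMem E a a Q → PMem E b b Q → ∃ y, OpRep E Q i a b y

theorem New.mem {K : Set ZFSet.{0}} (hK : TransPair K) (hop : OpReps (memOn K)) {Q y : ZFSet}
    (hQ : Q ∈ K) (hy : New memV Q y) : y ∈ K := by
  obtain ⟨-, i, a, b, ha, hb, hz⟩ := hy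
  have haK := (hK.fld_mem (Q := ⟨Q, hQ⟩) ha).1
  have hbK := (hK.fld_mem (Q := ⟨Q, hQ⟩) hb).1
  obtain ⟨y', hy'⟩ := hop ⟨Q, hQ⟩ ⟨a, haK⟩ ⟨b, hbK⟩ i (hK.pmemV.2 ha) (hK.pmemV.2 hb)
  rw [hK.opRep] at hy'
  convert y'.2
  ext z
  exact (hz z).trans (hy'.2.2 z).symm

theorem stageSpec_rset {K : Set ZFSet.{0}} (hK : TransPair K) (h0 : ∅ ∈ K)
    (hop : OpReps (memOn K)) : StageSpec (fun _ E => OrdBase E) (fun _ E => OrdNext E)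
    (fun _ E => OrdTag E) K (OrdBase memV) (OrdNext memV) (OrdTag memV) rset where
  trans := hK.trans
  base := hK.ordBase
  step := hK.ordNext
  prec := hK.ordTag
  base_mem := fun {x} hx => by
    rw [ordBase_memV.1 hx]
    exact hK.pair h0 h0
  step_mem := fun {Q p} hQ hp => by
    obtain ⟨x, y, hp, h⟩ := hp
    rw [isPair_memV] at hp
    subst hp
    rcases h with h | ⟨hx, hy⟩ | ⟨hx, hy, -⟩
    · have := hK.fld_mem (Q := ⟨Q, hQ⟩) h
      exact hK.pair this.1 this.2
    · exact hK.pair (hK.fld_mem (Q := ⟨Q, hQ⟩) hx).1 (hy.mem hK hop hQ)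
    · exact hK.pair (hx.mem hK hop hQ) (hy.mem hK hop hQ)
  mem_iff := mem_rset
  infl := fun {α p} hp => by
    obtain ⟨x, y, rfl⟩ := exists_pair_of_mem_rset hp
    exact ⟨x, y, isPair_memV.2 rfl, next_of_rle hp⟩
  wf := wellFounded_ordTag

theorem countable_fld {Q : ZFSet.{0}} (hQ : (Q : Set ZFSet).Countable) :
    {x : ZFSet | ZFSet.pair x x ∈ Q}.Countable :=
  hQ.preimage (f := fun x => ZFSet.pair x x) fun _ _ h => (ZFSet.pair_inj.1 h).1

theorem Tower.opReps {S : Ordinal.{0} → ZFSet.{0}} {K : Set ZFSet.{0}} (h : Tower S K) :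
    OpReps (memOn K) := by
  intro Q a b i ha hb
  have hK := h.transPair
  obtain ⟨y, hy, hmem⟩ := h.mem_of_udef (n := 3)
    (P := fun A E v z => PMem E z z (v 0) ∧ Op E i (v 1) (v 2) z)
    ((UDef.pmem _ _ _).and (UDef.op _ _ _ _)) ![Q, a, b]
    (((countable_fld (h.countable_of_mem Q.2)).preimage Subtype.val_injective).mono
      fun x hx => hK.pmem.1 hx.1)
  exact ⟨⟨y, hy⟩, ha, hb, fun z => (hmem z).trans ⟨fun ⟨_, h⟩ => h, fun h => ⟨z.2, h⟩⟩⟩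

/-- The field of every set exists. -/
def Flds {A : Type 1} (E : A → A → Prop) : Prop :=
  ∀ Q, ∃ d, ∀ x, E x d ↔ PMem E x x Q

theorem Tower.flds {S : Ordinal.{0} → ZFSet.{0}} {K : Set ZFSet.{0}} (h : Tower S K) :
    Flds (memOn K) := by
  intro Q
  have hK := h.transPair
  obtain ⟨y, hy, hmem⟩ := h.mem_of_udef (n := 1) (P := fun A E v z => PMem E z z (v 0))
    (UDef.pmem _ _ _) ![Q]
    (((countable_fld (h.countable_of_mem Q.2)).preimage Subtype.val_injective).mono
      fun x hx => hK.pmem.1 hx)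
  exact ⟨⟨y, hy⟩, fun z => (hmem z).trans ⟨fun ⟨_, h⟩ => h, fun h => ⟨z.2, h⟩⟩⟩

theorem ordLev_rset {α : Ordinal.{0}} (hα : α < Ordinal.omega 1) :
    ∃ hK : rset α ∈ LOmega1, OrdLev (memOn LOmega1) ⟨rset α, hK⟩ :=
  (stageSpec_rset tower_lset.transPair tower_lset.empty_mem tower_lset.opReps).lev_of_lt tower_lset
    ordTag_rset countable_rset UDef.ordBase UDef.ordNext UDef.ordTag hα

theorem WOmega1_eq : WOmega1 = LOmega1 := by
  refine Set.Subset.antisymm ?_ LOmega1_subset_WOmega1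
  rintro x ⟨α, hα, hx⟩
  exact (tower_lset.transPair.of_pair_mem (ordLev_rset hα).1 (mem_xset.1 hx)).1

/-! ### Well-orders of type `ω₁` -/

theorem type_eq_ord_aleph_one_iff {A : Type 1} {r : A → A → Prop} [IsWellOrder A r] :
    Ordinal.type r = (aleph 1).ord ↔ ¬ Countable A ∧ ∀ a, {b | r b a}.Countable := by
  have hlt : ∀ a, Ordinal.typein r a < (aleph 1).ord ↔ {b | r b a}.Countable := by
    intro a
    rw [Cardinal.lt_ord, Ordinal.card_typein, ← Cardinal.succ_aleph0, Order.lt_succ_iff]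
    exact Cardinal.le_aleph0_iff_set_countable
  constructor
  · intro h
    refine ⟨fun hc => ?_, fun a => (hlt a).1 (h ▸ Ordinal.typein_lt_type r a)⟩
    rw [← Cardinal.mk_le_aleph0_iff, ← Ordinal.card_type r, h, Cardinal.card_ord] at hc
    exact absurd hc (not_le.2 Cardinal.aleph0_lt_aleph_one)
  · rintro ⟨hu, hc⟩
    apply le_antisymm
    · by_contra! h
      obtain ⟨a, ha⟩ := Ordinal.typein_surj r h
      exact absurd ha ((hlt a).2 (hc a)).ne
    · refine le_trans (Cardinal.ord_le_ord.2 ?_) (Cardinal.ord_le_type r)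
      rw [← Cardinal.succ_aleph0, Order.succ_le_iff, ← not_le, Cardinal.mk_le_aleph0_iff]
      exact hu

theorem small_of_mk_eq_aleph_one {A : Type 1} (h : #A = aleph 1) : Small.{0} A := by
  have : #A = #(ULift.{1} (aleph 1 : Cardinal.{0}).out) := by simp [h]
  obtain ⟨e⟩ := Cardinal.eq.1 this
  exact ⟨_, ⟨e.trans Equiv.ulift⟩⟩

/-! ### The Mostowski collapse -/

theorem exists_collapse {A : Type 1} [Small.{0} A] {E : A → A → Prop} (hwf : WellFounded E)
    (hext : Extensional E) : ∃ (M : Set ZFSet.{0}) (e : A ≃ ↥M), (∀ x ∈ M, ∀ z ∈ x, z ∈ M) ∧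
      ∀ x y, E x y ↔ memOn M (e x) (e y) := by
  let f : A → ZFSet.{0} := hwf.fix fun a ih => ZFSet.range fun b : {b // E b a} => ih b.1 b.2
  have hf : ∀ a z, z ∈ f a ↔ ∃ b, E b a ∧ f b = z := by
    intro a z
    simp only [f]
    rw [hwf.fix_eq, ZFSet.mem_range]
    simp
  have hinj : Function.Injective f := by
    intro a
    induction a using hwf.induction with
    | _ a ih =>
      intro b hab
      refine hext a b fun z => ⟨fun hz => ?_, fun hz => ?_⟩
      · obtain ⟨c, hc, hcz⟩ := (hf b (f z)).1 (hab ▸ (hf a _).2 ⟨z, hz, rfl⟩)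
        rwa [ih z hz hcz.symm]
      · obtain ⟨c, hc, hcz⟩ := (hf a (f z)).1 (hab ▸ (hf b _).2 ⟨z, hz, rfl⟩)
        rwa [← ih c hc hcz]
  refine ⟨Set.range f, Equiv.ofInjective f hinj, ?_, fun x y => ?_⟩
  · rintro _ ⟨a, rfl⟩ z hz
    obtain ⟨b, -, rfl⟩ := (hf a z).1 hz
    exact ⟨b, rfl⟩
  · simp only [memOn, Equiv.ofInjective_apply, hf]
    exact ⟨fun h => ⟨x, h, rfl⟩, fun ⟨b, hb, h⟩ => hinj h ▸ hb⟩

theorem UDef.iso {ι : Type} {P} (h : UDef (ι := ι) P) {A B : Type 1} {E : A → A → Prop}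
    {F : B → B → Prop} (e : A ≃ B) (he : ∀ x y, E x y ↔ F (e x) (e y)) (v : ι → A) :
    P A E v ↔ P B F fun i => e (v i) := by
  obtain ⟨φ, hφ⟩ := h
  let _ := eStruc E
  let _ := eStruc F
  let g : memLang.Equiv A B := ⟨e, fun f => Empty.elim f, fun r x => (he _ _).symm⟩
  rw [← hφ, ← hφ]
  exact (Language.StrongHomClass.realize_formula g φ).symm

/-! ### The canonical order of a model -/

/-- The strict canonical order as seen by an `∈`-structure. -/
def WoRel {A : Type 1} (E : A → A → Prop) (x y : A) : Prop :=
  ¬ x = y ∧ ∃ R, OrdLev E R ∧ PMem E x y R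

theorem UDef.ordLev {ι : Type} (r : ι) : UDef fun _ E v => OrdLev E (v r) :=
  UDef.lev UDef.ordBase UDef.ordNext UDef.ordTag r

theorem UDef.woRel {ι : Type} (x y : ι) : UDef fun _ E v => WoRel E (v x) (v y) :=
  (UDef.eq _ _).not.and (.ex ((UDef.ordLev _).and (UDef.pmem _ _ _)))

/-- The fragment of set theory with `V = L` used to characterize `L_{ω₁}`: pairing, the empty set,
closure under the generating operations, fields, and every set occurring in a canonical order. -/
structure Fragment {A : Type 1} (E : A → A → Prop) : Prop where
  upair : ∀ x y, ∃ p, ∀ z, E z p ↔ z = x ∨ z = y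
  empty : ∃ x, ∀ z, ¬ E z x
  opReps : OpReps E
  flds : Flds E
  levels : ∀ x, ∃ R, OrdLev E R ∧ PMem E x x R

theorem UDef.fragment : UDef (ι := Empty) fun _ E _ => Fragment E := by
  have h1 : UDef (ι := Empty) fun A E _ => ∀ x y : A, ∃ p, ∀ z, E z p ↔ z = x ∨ z = y :=
    .all (.all (.ex (.all ((UDef.mem _ _).iff ((UDef.eq _ _).or (UDef.eq _ _))))))
  have h2 : UDef (ι := Empty) fun A E _ => ∃ x : A, ∀ z, ¬ E z x :=
    .ex (.all (UDef.mem _ _).not)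
  have h3 : UDef (ι := Empty) fun A E _ => OpReps E :=
    .all (.all (.all (UDef.allFin fun _ => (UDef.pmem _ _ _).imp ((UDef.pmem _ _ _).imp
      (.ex (UDef.opRep _ _ _ _ _))))))
  have h4 : UDef (ι := Empty) fun A E _ => Flds E :=
    .all (.ex (.all ((UDef.mem _ _).iff (UDef.pmem _ _ _))))
  have h5 : UDef (ι := Empty) fun A E _ => ∀ x : A, ∃ R, OrdLev E R ∧ PMem E x x R :=
    .all (.ex ((UDef.ordLev _).and (UDef.pmem _ _ _)))
  exact (h1.and (h2.and (h3.and (h4.and h5)))).congr fun _ _ _ =>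
    ⟨fun ⟨a, b, c, d, e⟩ => ⟨a, b, c, d, e⟩, fun ⟨a, b, c, d, e⟩ => ⟨a, b, c, d, e⟩⟩

namespace Fragment

variable {M : Set ZFSet.{0}}

theorem transPair (h : Fragment (memOn M)) (ht : ∀ x ∈ M, ∀ z ∈ x, z ∈ M) : TransPair M := by
  refine ⟨fun {x z} hx hz => ht x hx z hz, fun {x y} hx hy => ?_⟩
  obtain ⟨p, hp⟩ := h.upair ⟨x, hx⟩ ⟨y, hy⟩
  convert p.2
  ext z
  rw [ZFSet.mem_pair]
  constructor
  · rintro (rfl | rfl)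
    exacts [(hp ⟨_, hx⟩).2 (Or.inl rfl), (hp ⟨_, hy⟩).2 (Or.inr rfl)]
  · intro hz
    exact ((hp ⟨z, ht _ p.2 z hz⟩).1 hz).imp (congrArg Subtype.val) (congrArg Subtype.val)

theorem empty_mem (h : Fragment (memOn M)) (ht : ∀ x ∈ M, ∀ z ∈ x, z ∈ M) : ∅ ∈ M := by
  obtain ⟨x, hx⟩ := h.empty
  convert x.2
  exact ((ZFSet.eq_empty _).2 fun z hz => hx ⟨z, ht _ x.2 z hz⟩ hz).symm

theorem exists_rset (h : Fragment (memOn M)) (ht : ∀ x ∈ M, ∀ z ∈ x, z ∈ M) {x : ZFSet}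
    (hx : x ∈ M) : ∃ (α : _) (hK : rset α ∈ M), OrdLev (memOn M) ⟨rset α, hK⟩ ∧ x ∈ xset α := by
  have hM := h.transPair ht
  obtain ⟨R, hR, hxR⟩ := h.levels ⟨x, hx⟩
  obtain ⟨α, hα⟩ := (stageSpec_rset hM (h.empty_mem ht) h.opReps).exists_eq_of_lev hR
  rw [hM.pmem] at hxR
  obtain ⟨R, hRM⟩ := R
  subst hα
  exact ⟨α, hRM, hR, mem_xset.2 hxR⟩

theorem xset_mem (h : Fragment (memOn M)) (ht : ∀ x ∈ M, ∀ z ∈ x, z ∈ M) {α : Ordinal.{0}}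
    (hα : rset α ∈ M) : xset α ∈ M := by
  have hM := h.transPair ht
  obtain ⟨d, hd⟩ := h.flds ⟨rset α, hα⟩
  simp only [hM.pmem] at hd
  rw [hM.ext_iff d.2 (p := fun x => ZFSet.pair x x ∈ rset α)
    fun z hz => (hM.of_pair_mem hα hz).1] at hd
  convert d.2
  ext z
  rw [mem_xset, hd, rle]

end Fragment

theorem not_countable_WOmega1 : ¬ WOmega1.Countable := by
  intro hc
  obtain ⟨α, hα, h⟩ := tower_xset.exists_stage hc subset_rfl
  exact ZFSet.mem_irrefl _ (h _ (xset_mem_WOmega1 hα))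

theorem Fragment.eq_LOmega1 {M : Set ZFSet.{0}} (h : Fragment (memOn M))
    (ht : ∀ x ∈ M, ∀ z ∈ x, z ∈ M) (hu : ¬ M.Countable)
    (hc : ∀ a, {b | WoRel (memOn M) b a}.Countable) : M = LOmega1 := by
  have hM := h.transPair ht
  have hlt : ∀ α, rset α ∈ M → α < Ordinal.omega 1 := by
    intro α hα
    by_contra! hle
    have hX := h.xset_mem ht hα
    obtain ⟨γ, hγ, hlev, hXγ⟩ := h.exists_rset ht hX
    refine not_countable_WOmega1 (((hc ⟨_, hX⟩).image Subtype.val).mono ?_)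
    rintro x ⟨β, hβ, hx⟩
    have hx := xset_mono (hβ.le.trans hle) hx
    refine ⟨⟨x, ht _ hX x hx⟩, ⟨?_, ⟨_, hγ⟩, hlev, hM.pmem.2 ?_⟩, rfl⟩
    · rw [Subtype.ext_iff]
      rintro rfl
      exact ZFSet.mem_irrefl _ hx
    · exact rle_of_not_fld (xset_mem_xset.1 hXγ).le (mem_xset.1 hx) (mem_xset.1 hXγ)
        fun h => ZFSet.mem_irrefl _ (mem_xset.2 h)
  rw [← WOmega1_eq]
  refine Set.Subset.antisymm (fun x hx => ?_) ?_
  · obtain ⟨α, hα, -, hxα⟩ := h.exists_rset ht hx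
    exact ⟨α, hlt α hα, hxα⟩
  · rintro x ⟨β, hβ, hx⟩
    by_contra hxM
    refine hu ((countable_xset hβ).mono fun y hy => ?_)
    obtain ⟨α, hα, -, hyα⟩ := h.exists_rset ht hy
    refine xset_mono ?_ hyα
    by_contra! hlt
    exact hxM (ht _ (h.xset_mem ht hα) x (xset_mono hlt.le hx))

theorem fragment_LOmega1 : Fragment (memOn LOmega1) where
  upair := fun x y => ⟨⟨_, tower_lset.transPair.upair x.2 y.2⟩, fun z => by
    simp [memOn, Subtype.ext_iff]⟩
  empty := ⟨⟨∅, tower_lset.empty_mem⟩, fun z => ZFSet.notMem_empty _⟩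
  opReps := tower_lset.opReps
  flds := tower_lset.flds
  levels := fun x => by
    obtain ⟨α, hα, hx⟩ : (x : ZFSet) ∈ WOmega1 := LOmega1_subset_WOmega1 x.2
    obtain ⟨hK, hlev⟩ := ordLev_rset hα
    exact ⟨_, hlev, tower_lset.transPair.pmem.2 (mem_xset.1 hx)⟩

/-! ### The canonical order of `L_{ω₁}` -/

theorem exists_rle_of_woRel {x y : ↥LOmega1} (h : WoRel (memOn LOmega1) x y) :
    ∃ α, rle α x y := by
  obtain ⟨-, R, hR, hxy⟩ := h
  obtain ⟨α, hα⟩ := (stageSpec_rset tower_lset.transPair tower_lset.empty_mem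
    tower_lset.opReps).exists_eq_of_lev hR
  rw [tower_lset.transPair.pmem, hα] at hxy
  exact ⟨α, hxy⟩

theorem woRel_iff {α : Ordinal.{0}} (hα : α < Ordinal.omega 1) {x y : ↥LOmega1}
    (hy : (y : ZFSet) ∈ xset α) : WoRel (memOn LOmega1) x y ↔ x ≠ y ∧ rle α x y := by
  constructor
  · intro h
    refine ⟨h.1, ?_⟩
    obtain ⟨β, hβ⟩ := exists_rle_of_woRel h
    rcases le_total α β with hle | hle
    · exact rle_of_fld hle hβ (mem_xset.1 hy)
    · exact rle_mono hle hβ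
  · rintro ⟨hne, h⟩
    obtain ⟨hK, hlev⟩ := ordLev_rset hα
    exact ⟨hne, _, hlev, tower_lset.transPair.pmem.2 h⟩

theorem isWellOrder_woRel : IsWellOrder ↥LOmega1 (WoRel (memOn LOmega1)) := by
  have hstage : ∀ x : ↥LOmega1, ∃ α < Ordinal.omega 1, (x : ZFSet) ∈ xset α := fun x =>
    LOmega1_subset_WOmega1 x.2
  refine @IsWellOrder.mk _ _ ⟨WellFounded.wellFounded_iff_has_min.2 fun S ⟨x, hx⟩ => ?_⟩
    ⟨fun x y hxy hyx => ?_⟩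
  · obtain ⟨α, hα, hxα⟩ := hstage x
    obtain ⟨m, ⟨hm, hmα⟩, hmin⟩ := (wo_rle α).least (S := (Subtype.val '' S) ∩ {x | rle α x x})
      ⟨x, ⟨x, hx, rfl⟩, mem_xset.1 hxα⟩ fun _ h => h.2
    obtain ⟨m, hmS, rfl⟩ := hm
    refine ⟨m, hmS, fun y hy hlt => ?_⟩
    obtain ⟨hne, hle⟩ := (woRel_iff hα (mem_xset.2 hmα)).1 hlt
    exact hne (Subtype.ext ((wo_rle α).antisymm hle (hmin y ⟨⟨y, hy, rfl⟩,
      ((wo_rle α).fld hle).1⟩)))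
  · obtain ⟨α, hα, hxα⟩ := hstage x
    obtain ⟨β, hβ, hyβ⟩ := hstage y
    have hγ := max_lt hα hβ
    have hx := xset_mono (le_max_left α β) hxα
    have hy := xset_mono (le_max_right α β) hyβ
    by_contra hne
    rcases (wo_rle _).total (mem_xset.1 hx) (mem_xset.1 hy) with h | h
    · exact hxy ((woRel_iff hγ hy).2 ⟨hne, h⟩)
    · exact hyx ((woRel_iff hγ hx).2 ⟨Ne.symm hne, h⟩)

theorem countable_setOf_woRel (a : ↥LOmega1) : {b | WoRel (memOn LOmega1) b a}.Countable := by
  obtain ⟨α, hα, ha⟩ : (a : ZFSet) ∈ WOmega1 := LOmega1_subset_WOmega1 a.2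
  refine ((countable_xset hα).preimage Subtype.val_injective).mono fun b hb => ?_
  exact mem_xset.2 ((wo_rle α).fld ((woRel_iff hα ha).1 hb).2).1

/-- `L_{ω₁}` is, up to isomorphism, the unique well-founded (extensional)
model of a sufficiently strong fragment `T` of `ZF⁻ + V = L` in which the canonical
definable well-order `<_L` (given by a formula `wo`) has order type exactly `ω₁`:
there are a theory `T` true in `(L_{ω₁}, ∈)` and a formula `wo` defining on `L_{ω₁}` a
well-order of order type `ω₁`, such that every well-founded extensional model of `T` in
which `wo` defines a well-order of order type `ω₁` is isomorphic to `(L_{ω₁}, ∈)`. -/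
theorem stmt19 :
    ∃ (T : Set memLang.Sentence) (wo : memLang.Formula (Fin 2)),
      (∀ σ ∈ T, SatSen (fun x y : ↥LOmega1 => (x : ZFSet) ∈ (y : ZFSet)) σ) ∧
      (∃ hwo : IsWellOrder ↥LOmega1
          (DefRel (fun x y : ↥LOmega1 => (x : ZFSet) ∈ (y : ZFSet)) wo),
        @Ordinal.type _ _ hwo = (aleph 1).ord) ∧
      ∀ (A : Type 1) (E : A → A → Prop), WellFounded E → Extensional E →
        (∀ σ ∈ T, SatSen E σ) →
        ∀ hwoA : IsWellOrder A (DefRel E wo), @Ordinal.type _ _ hwoA = (aleph 1).ord →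
          ∃ e : A ≃ ↥LOmega1, ∀ x y : A, E x y ↔ ((e x : ZFSet) ∈ (e y : ZFSet)) := by

  obtain ⟨σ, hσ⟩ := UDef.fragment
  obtain ⟨wo, hwo⟩ := UDef.woRel (ι := Fin 2) 0 1
  have hsat : ∀ {A : Type 1} (E : A → A → Prop), SatSen E σ ↔ Fragment E := fun E => hσ _ E default
  have hrel : ∀ {A : Type 1} (E : A → A → Prop), DefRel E wo = WoRel E := fun E => by
    funext a b
    exact propext (hwo _ E ![a, b])
  refine ⟨{σ}, wo, ?_, ?_, ?_⟩
  · rintro _ rfl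
    exact (hsat _).2 fragment_LOmega1
  · rw [hrel]
    have := isWellOrder_woRel
    refine ⟨this, type_eq_ord_aleph_one_iff.2 ⟨?_, countable_setOf_woRel⟩⟩
    rw [← WOmega1_eq]
    exact not_countable_WOmega1
  · intro A E hwf hext hT hwoA htype
    have hcard : #A = aleph 1 := by rw [← Ordinal.card_type (DefRel E wo), htype, Cardinal.card_ord]
    have := small_of_mk_eq_aleph_one hcard
    obtain ⟨hu, hc⟩ := type_eq_ord_aleph_one_iff.1 htype
    obtain ⟨M, e, ht, he⟩ := exists_collapse hwf hext
    have hfrag : Fragment (memOn M) :=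
      (UDef.fragment.iso e he Empty.elim).1 ((hsat E).1 (hT σ rfl))
    have hML : M = LOmega1 := by
      refine hfrag.eq_LOmega1 ht (fun h => hu ?_) fun a => ?_
      · have : Countable ↥M := h
        exact e.countable_iff.2 this
      · refine ((hc (e.symm a)).preimage e.symm.injective).mono fun b hb => ?_
        have := (UDef.woRel (ι := Fin 2) 0 1).iso e he ![e.symm b, e.symm a]
        simp only [Matrix.cons_val_zero, Matrix.cons_val_one, Equiv.apply_symm_apply] at this
        rw [Set.mem_preimage, Set.mem_ofPred_eq, hrel]
        exact this.2 hb
    subst hML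
    exact ⟨e, he⟩
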